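/- arXiv:math/0610237 — 3 statements merged into one kernel-verified Lean document; each statement's English description precedes it below -/
import Mathlib

section
/- Every Motzkin permutation π of length n satisfies lds(π) + (number of rises of π) = n, and for all n, r ≥ 0 the number of Motzkin permutations of length n with exactly r rises (equivalently, with lds equal to n − r) is (1/(r+1))·binom(2r, r)·binom(n, 2r). -/
/-- `π` avoids the classical pattern 132. -/
def Avoids132 {n : ℕ} (π : Equiv.Perm (Fin n)) : Prop :=
  ¬ ∃ i j k : Fin n, i < j ∧ j < k ∧ π i < π k ∧ π k < π j

/-- `π` avoids the generalized pattern 1-23. -/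
def Avoids1_23 {n : ℕ} (π : Equiv.Perm (Fin n)) : Prop :=
  ¬ ∃ (a b : Fin n) (h : (b : ℕ) + 1 < n), a < b ∧ π a < π b ∧ π b < π ⟨(b : ℕ) + 1, h⟩

/-- A Motzkin permutation avoids both 132 and 1-23. -/
def IsMotzkinPerm {n : ℕ} (π : Equiv.Perm (Fin n)) : Prop :=
  Avoids132 π ∧ Avoids1_23 π

/-- Length of the longest decreasing subsequence of `π`. -/
noncomputable def lds {n : ℕ} (π : Equiv.Perm (Fin n)) : ℕ :=
  sSup {m : ℕ | ∃ f : Fin m → Fin n, StrictMono f ∧ StrictAnti fun i => π (f i)}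

/-- The number of rises of `π`: indices `i` with `π i < π (i+1)`. -/
noncomputable def rises {n : ℕ} (π : Equiv.Perm (Fin n)) : ℕ :=
  Nat.card {i : Fin n // ∃ h : (i : ℕ) + 1 < n, π i < π ⟨(i : ℕ) + 1, h⟩}

inductive MTree where
  | e : MTree
  | c : MTree → MTree
  | nd : MTree → MTree → MTree

namespace MTree

def sz : MTree → ℕ
  | e => 0
  | c R => sz R + 1
  | nd L R => sz L + 1 + 1 + sz R

def nn : MTree → ℕ
  | e => 0
  | c R => nn R
  | nd L R => nn L + 1 + nn R

def ev : MTree → ℕ → ℕ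
  | e, _ => 0
  | c R, i => if i = 0 then sz R else ev R (i - 1)
  | nd L R, i =>
    if i < sz L then ev L i + (sz R + 1)
    else if i = sz L then sz R
    else if i = sz L + 1 then sz L + sz R + 1
    else ev R (i - sz L - 2)

theorem ev_lt (t : MTree) : ∀ i < t.sz, t.ev i < t.sz := by
  induction t with
  | e => simp [sz]
  | c R ih =>
    intro i hi
    simp only [sz, ev] at *
    split_ifs
    · omega
    · have := ih (i - 1) (by omega); omega
  | nd L R ihL ihR =>
    intro i hi
    simp only [sz, ev] at *
    split_ifs
    · have := ihL i (by omega); omega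
    · omega
    · omega
    · have := ihR (i - L.sz - 2) (by omega); omega

theorem ev_inj (t : MTree) : ∀ i < t.sz, ∀ j < t.sz, t.ev i = t.ev j → i = j := by
  induction t with
  | e => simp [sz]
  | c R ih =>
    intro i hi j hj h
    have hR := ev_lt R
    simp only [sz, ev] at *
    have h1 := hR (i - 1)
    have h2 := hR (j - 1)
    have h3 := ih (i - 1)
    have h4 := fun a => h3 a (j - 1)
    split_ifs at h <;> grind
  | nd L R ihL ihR =>
    intro i hi j hj h
    have hR := ev_lt R
    have hL := ev_lt L
    simp only [sz, ev] at *
    have h1 := hR (i - L.sz - 2)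
    have h2 := hR (j - L.sz - 2)
    have h3 := hL i
    have h4 := hL j
    have h5 := fun a => ihL i a j
    have h6 := fun a => ihR (i - L.sz - 2) a (j - L.sz - 2)
    split_ifs at h <;> omega

end MTree

def Mz (n : ℕ) (f : ℕ → ℕ) : Prop :=
  (∀ i j k, ¬ (i < j ∧ j < k ∧ k < n ∧ f i < f k ∧ f k < f j)) ∧
  (∀ a b, ¬ (a < b ∧ b + 1 < n ∧ f a < f b ∧ f b < f (b + 1)))

def rs (n : ℕ) (f : ℕ → ℕ) : ℕ :=
  ∑ i ∈ Finset.range n, if i + 1 < n ∧ f i < f (i + 1) then 1 else 0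

namespace MTree

set_option maxHeartbeats 2000000 in
theorem ev_mz (t : MTree) : Mz t.sz t.ev := by
  induction t with
  | e => simp [sz, Mz]
  | c R ih =>
    have hR := ev_lt R
    obtain ⟨ih1, ih2⟩ := ih
    constructor
    · rintro i j k ⟨hij, hjk, hk, h1, h2⟩
      have a1 := hR (k - 1)
      have a2 := ih1 (i - 1) (j - 1) (k - 1)
      simp only [sz, ev] at *
      split_ifs at h1 h2 <;> omega
    · rintro a b ⟨hab, hb, h1, h2⟩
      have a1 := hR (b - 1)
      have a2 := ih2 (a - 1) (b - 1)
      simp only [sz, ev] at *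
      have e1 : b - 1 + 1 = b + 1 - 1 := by omega
      rw [e1] at a2
      split_ifs at h1 h2 <;> omega
  | nd L R ihL ihR =>
    have hR := ev_lt R
    have hL := ev_lt L
    obtain ⟨iL1, iL2⟩ := ihL
    obtain ⟨iR1, iR2⟩ := ihR
    constructor
    · rintro i j k ⟨hij, hjk, hk, h1, h2⟩
      have a1 := hR (k - L.sz - 2)
      have a2 := hR (j - L.sz - 2)
      have a3 := hR (i - L.sz - 2)
      have b1 := hL k
      have b2 := hL j
      have b3 := hL i
      have a4 := iR1 (i - L.sz - 2) (j - L.sz - 2) (k - L.sz - 2)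
      have a5 := iL1 i j k
      simp only [sz, ev] at *
      split_ifs at h1 h2 <;> omega
    · rintro a b ⟨hab, hb, h1, h2⟩
      have a1 := hR (b + 1 - L.sz - 2)
      have a2 := hR (b - L.sz - 2)
      have a3 := hR (a - L.sz - 2)
      have b1 := hL (b + 1)
      have b2 := hL b
      have b3 := hL a
      have a4 := iR2 (a - L.sz - 2) (b - L.sz - 2)
      have a5 := iL2 a b
      simp only [sz, ev] at *
      by_cases hc : L.sz + 2 ≤ b
      · have e1 : b - L.sz - 2 + 1 = b + 1 - L.sz - 2 := by omega
        rw [e1] at a4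
        split_ifs at h1 h2 <;> omega
      · split_ifs at h1 h2 <;> omega

theorem ev_rs (t : MTree) : rs t.sz t.ev = t.nn := by
  induction t with
  | e => simp [sz, rs, nn]
  | c R ih =>
    have hR := ev_lt R
    rw [nn, ← ih]
    unfold rs
    rw [sz, Finset.sum_range_succ']
    have h0 := hR 0
    have hn : ¬ (0 + 1 < R.sz + 1 ∧ (c R).ev 0 < (c R).ev (0 + 1)) := by
      simp [ev]; intro h; exact (h0 h).le
    rw [if_neg hn, add_zero]
    apply Finset.sum_congr rfl
    intro i hi
    refine if_congr ?_ rfl rfl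
    simp [ev]
  | nd L R ihL ihR =>
    have hR := ev_lt R
    have hL := ev_lt L
    rw [nn, ← ihL, ← ihR]
    unfold rs
    rw [sz, Finset.sum_range_add, Finset.sum_range_succ, Finset.sum_range_succ]
    have e1 : ∀ i ∈ Finset.range L.sz, (if i + 1 < L.sz + 1 + 1 + R.sz ∧ (L.nd R).ev i < (L.nd R).ev (i + 1) then 1 else 0) = (if i + 1 < L.sz ∧ L.ev i < L.ev (i + 1) then 1 else 0) := by
      intro i hi
      rw [Finset.mem_range] at hi
      refine if_congr ?_ rfl rfl
      simp only [ev, hi, if_true]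
      by_cases h : i + 1 < L.sz
      · simp only [h, if_true, add_lt_add_iff_right, true_and]
        constructor
        · exact fun x => x.2
        · exact fun x => ⟨by omega, x⟩
      · have : i + 1 = L.sz := by omega
        simp only [this, if_true]; simp; omega
    have e2 : ∀ i ∈ Finset.range R.sz, (if L.sz + 1 + 1 + i + 1 < L.sz + 1 + 1 + R.sz ∧ (L.nd R).ev (L.sz + 1 + 1 + i) < (L.nd R).ev (L.sz + 1 + 1 + i + 1) then 1 else 0) = (if i + 1 < R.sz ∧ R.ev i < R.ev (i + 1) then 1 else 0) := by
      intro i hi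
      refine if_congr ?_ rfl rfl
      simp only [ev]
      rw [if_neg (by omega), if_neg (by omega), if_neg (by omega), if_neg (by omega), if_neg (by omega), if_neg (by omega)]
      rw [show L.sz + 1 + 1 + i - L.sz - 2 = i by omega, show L.sz + 1 + 1 + i + 1 - L.sz - 2 = i + 1 by omega]
      omega
    rw [Finset.sum_congr rfl e1, Finset.sum_congr rfl e2]
    have c1 : L.sz + 1 < L.sz + 1 + 1 + R.sz ∧ (L.nd R).ev L.sz < (L.nd R).ev (L.sz + 1) := by
      simp [ev]; omega
    have c2 : ¬ (L.sz + 1 + 1 < L.sz + 1 + 1 + R.sz ∧ (L.nd R).ev (L.sz + 1) < (L.nd R).ev (L.sz + 1 + 1)) := by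
      have := hR (L.sz + 1 + 1 - L.sz - 2)
      simp only [ev]
      split_ifs <;> omega
    rw [if_pos c1, if_neg c2]

theorem ev_unique (t : MTree) : ∀ t' : MTree, t.sz = t'.sz → (∀ i < t.sz, t.ev i = t'.ev i) → t = t' := by
  induction t with
  | e =>
    intro t' h _
    cases t' <;> simp [sz] at h ⊢
    omega
  | c R ih =>
    intro t' h hh
    cases t' with
    | e => simp [sz] at h
    | c R' =>
      congr 1
      apply ih
      · simpa [sz] using h
      · intro i hi
        simpa [ev] using hh (i + 1) (by simp [sz, hi])
    | nd L' R' =>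
      exfalso
      have h0 := hh 0 (by simp [sz])
      have := ev_lt L' 0
      simp only [sz, ev] at *
      split_ifs at h0 <;> omega
  | nd L R ihL ihR =>
    intro t' h hh
    cases t' with
    | e => simp [sz] at h
    | c R' =>
      exfalso
      have h0 := hh 0 (by simp only [sz]; omega)
      have := ev_lt L 0
      simp only [sz, ev] at *
      split_ifs at h0 <;> omega
    | nd L' R' =>
      have hs : L.sz = L'.sz := by
        have h0 := hh (L.sz + 1) (by simp [sz]; omega)
        have := ev_lt L' (L.sz + 1)
        have := ev_lt R' (L.sz + 1 - L'.sz - 2)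
        simp only [sz, ev] at *
        split_ifs at h0 <;> omega
      have hs' : R.sz = R'.sz := by simp only [sz] at h; omega
      congr 1
      · apply ihL _ hs
        intro i hi
        have := hh i (by simp [sz]; omega)
        simp only [ev] at this
        rw [if_pos hi, if_pos (by omega)] at this
        omega
      · apply ihR _ hs'
        intro i hi
        have := hh (L.sz + 2 + i) (by simp [sz]; omega)
        simp only [ev] at this
        rw [← hs, if_neg (by omega), if_neg (by omega), if_neg (by omega), if_neg (by omega), if_neg (by omega), if_neg (by omega)] at this
        rwa [show L.sz + 2 + i - L.sz - 2 = i by omega] at this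

theorem ev_surj (n : ℕ) : ∀ f : ℕ → ℕ, (∀ i < n, f i < n) →
    (∀ i < n, ∀ j < n, f i = f j → i = j) → Mz n f →
    ∃ t : MTree, t.sz = n ∧ ∀ i < n, t.ev i = f i := by
  induction n using Nat.strong_induction_on with
  | _ n ih =>
  intro f hm hi hM
  rcases Nat.eq_zero_or_pos n with rfl | hn
  · exact ⟨e, rfl, by simp⟩
  have hs : ∃ p < n, f p = n - 1 := by
    have := Finset.surj_on_of_inj_on_of_card_le (s := Finset.range n) (t := Finset.range n)
      (fun a _ => f a) (by intro a ha; simp at *; exact hm a ha)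
      (by intro a b ha hb h; simp at *; exact hi a ha b hb h) le_rfl (n - 1) (by simp; omega)
    obtain ⟨a, ha, hb⟩ := this
    exact ⟨a, by simpa using ha, hb.symm⟩
  obtain ⟨p, hp, hpn⟩ := hs
  have hlt : ∀ i < n, i ≠ p → f i < n - 1 := by
    intro i hin hne
    have h1 := hm i hin
    have h2 := hi i hin p hp
    omega
  rcases Nat.eq_zero_or_pos p with rfl | hp0
  · obtain ⟨R, hR, hR'⟩ := ih (n - 1) (by omega) (fun i => f (i + 1))
      (fun i h => hlt _ (by omega) (by omega))
      (fun i h j h' hh => by have := hi (i + 1) (by omega) (j + 1) (by omega) hh; omega)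
      ⟨fun i j k h => hM.1 (i + 1) (j + 1) (k + 1) ⟨by omega, by omega, by omega, h.2.2.2⟩,
       fun a b h => hM.2 (a + 1) (b + 1) ⟨by omega, by omega, h.2.2⟩⟩
    refine ⟨c R, by simp [sz]; omega, ?_⟩
    intro i hin
    simp only [ev]
    split_ifs with h
    · subst h; omega
    · rw [hR' _ (by omega)]; congr 1; omega
  · have hgt : ∀ i < p, ∀ k < n, p < k → f k < f i := by
      intro i hip k hk hpk
      have h1 := hM.1 i p k
      have h2 := hlt k hk (by omega)
      have h3 := hi i (by omega) k hk
      omega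
    have hmin : ∀ i < p - 1, f (p - 1) < f i := by
      intro i hip
      have h1 := hM.2 i (p - 1)
      rw [show p - 1 + 1 = p by omega] at h1
      have h2 := hlt (p - 1) (by omega) (by omega)
      have h3 := hi i (by omega) (p - 1) (by omega)
      omega
    have hR1 : ∀ k < n, p < k → f k < n - 1 - p := by
      intro k hk hpk
      have := Finset.card_le_card_of_injOn (s := Finset.range (p + 1)) (t := Finset.Ioo (f k) n) f
        (by
          intro i hip
          simp only [Finset.coe_range, Set.mem_Iio, Finset.coe_Ioo, Set.mem_Ioo] at *
          refine ⟨?_, hm i (by omega)⟩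
          rcases Nat.lt_or_ge i p with h | h
          · exact hgt i h k hk hpk
          · have : i = p := by omega
            subst this
            have := hlt k hk (by omega)
            omega)
        (by
          intro i h1 j h2 h
          simp only [Finset.coe_range, Set.mem_Iio] at *
          exact hi i (by omega) j (by omega) h)
      simp at this
      omega
    have hL1 : ∀ i < p, n - 1 - p ≤ f i := by
      intro i hip
      have := Finset.card_le_card_of_injOn (s := Finset.Ioo p n) (t := Finset.range (f i)) f
        (by
          intro k hk
          simp only [Finset.coe_range, Set.mem_Iio, Finset.coe_Ioo, Set.mem_Ioo] at *
          exact hgt i hip k hk.2 hk.1)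
        (by
          intro i h1 j h2 h
          simp only [Finset.coe_Ioo, Set.mem_Ioo] at *
          exact hi i (by omega) j (by omega) h)
      simp at this
      omega
    have hm1 : f (p - 1) ≤ n - 1 - p := by
      have := Finset.card_le_card_of_injOn (s := Finset.range (p - 1)) (t := Finset.Ioo (f (p - 1)) (n - 1)) f
        (by
          intro i hip
          simp only [Finset.coe_range, Set.mem_Iio, Finset.coe_Ioo, Set.mem_Ioo] at *
          exact ⟨hmin i hip, hlt i (by omega) (by omega)⟩)
        (by
          intro i h1 j h2 h
          simp only [Finset.coe_range, Set.mem_Iio] at *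
          exact hi i (by omega) j (by omega) h)
      have h2 := hlt (p - 1) (by omega) (by omega)
      simp at this
      omega
    have hmm := hL1 (p - 1) (by omega)
    have hL2 : ∀ i < p - 1, n - p ≤ f i := by
      intro i hip
      have := hmin i hip
      omega
    obtain ⟨R, hR, hR'⟩ := ih (n - 1 - p) (by omega) (fun i => f (p + 1 + i))
      (fun i h => hR1 _ (by omega) (by omega))
      (fun i h j h' hh => by have := hi _ (by omega) _ (by omega) hh; omega)
      ⟨fun i j k h => hM.1 (p + 1 + i) (p + 1 + j) (p + 1 + k) ⟨by omega, by omega, by omega, h.2.2.2⟩,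
       fun a b h => hM.2 (p + 1 + a) (p + 1 + b) ⟨by omega, by omega, h.2.2⟩⟩
    obtain ⟨L, hL, hL'⟩ := ih (p - 1) (by omega) (fun i => f i - (n - p))
      (fun i h => by
        have := hlt i (by omega) (by omega)
        have := hL2 i h
        omega)
      (fun i h j h' hh => by
        have h1 := hL2 i h
        have h2 := hL2 j h'
        exact hi i (by omega) j (by omega) (by omega))
      ⟨fun i j k h => by
        have := hM.1 i j k
        beta_reduce at h
        omega,
       fun a b h => by
        have := hM.2 a b
        beta_reduce at h
        omega⟩
    refine ⟨nd L R, by simp [sz]; omega, ?_⟩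
    intro i hin
    simp only [ev]
    split_ifs with h1 h2 h3
    · rw [hL' _ (by omega)]
      have := hL2 i (by omega)
      omega
    · have : i = p - 1 := by omega
      subst this; omega
    · have : i = p := by omega
      subst this; omega
    · rw [hR' _ (by omega)]
      congr 1
      omega

theorem choose_conv (a b m : ℕ) :
    ∑ x ∈ Finset.HasAntidiagonal.antidiagonal m, x.1.choose a * x.2.choose b = (m + 1).choose (a + b + 1) := by
  induction b generalizing m with
  | zero =>
    simp
    rw [Finset.Nat.sum_antidiagonal_eq_sum_range_succ (fun i _ => i.choose a)]
    induction m with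
    | zero => rcases a with _ | a <;> simp [Nat.choose_eq_zero_of_lt]
    | succ m ihm => rw [Finset.sum_range_succ, ihm, Nat.choose_succ_succ (m + 1)]; simp only [Nat.succ_eq_add_one]; ring
  | succ b ihb =>
    induction m with
    | zero => simp; symm; exact Nat.choose_eq_zero_of_lt (by omega)
    | succ m ihm =>
      rw [Finset.Nat.sum_antidiagonal_succ']
      simp only [Nat.choose_succ_succ, Nat.choose_zero_succ, mul_add, Finset.sum_add_distrib] at *
      rw [ihb, ihm]
      simp only [Nat.choose_succ_succ, ← add_assoc, Nat.succ_eq_add_one]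
      ring

theorem count (n : ℕ) : ∀ r, ∃ F : Finset MTree, (∀ t, t ∈ F ↔ t.sz = n ∧ t.nn = r) ∧
    F.card = catalan r * n.choose (2 * r) := by
  classical
  induction n using Nat.strong_induction_on with
  | _ n ih =>
  intro r
  rcases n with _ | n
  · rcases r with _ | r
    · refine ⟨{e}, ?_, by simp⟩
      intro t
      cases t <;> simp [sz, nn]
    · refine ⟨∅, ?_, by simp [mul_add]⟩
      intro t
      cases t <;> simp [sz, nn]
  · choose! F hF hc using ih
    rcases r with _ | r
    · refine ⟨(F n 0).image c, ?_, ?_⟩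
      · intro t
        simp only [Finset.mem_image]
        cases t <;> simp [sz, nn, hF]
      · rw [Finset.card_image_of_injective _ (fun a b h => by simpa using h), hc _ (by omega)]
        simp
    · rcases n with _ | n
      · refine ⟨∅, ?_, by rw [Nat.choose_eq_zero_of_lt (by omega)]; simp⟩
        intro t
        cases t with
        | e => simp [sz]
        | c R => cases R <;> simp [sz, nn]
        | nd L R => simp [sz]; omega
      · let G : Finset MTree := (Finset.HasAntidiagonal.antidiagonal n ×ˢ Finset.HasAntidiagonal.antidiagonal r).biUnion
          (fun x => (F x.1.1 x.2.1 ×ˢ F x.1.2 x.2.2).image (fun y => nd y.1 y.2))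
        have hG : ∀ t, t ∈ G ↔ ∃ L R, t = nd L R ∧ L.sz + R.sz = n ∧ L.nn + R.nn = r := by
          intro t
          simp only [G, Finset.mem_biUnion, Finset.mem_product, Finset.HasAntidiagonal.mem_antidiagonal, Finset.mem_image]
          constructor
          · rintro ⟨⟨⟨i, j⟩, ⟨s, u⟩⟩, ⟨h1, h2⟩, ⟨L, R⟩, ⟨h3, h4⟩, rfl⟩
            simp only at *
            rw [hF _ (by omega)] at h3 h4
            exact ⟨L, R, rfl, by omega, by omega⟩
          · rintro ⟨L, R, rfl, h1, h2⟩
            refine ⟨⟨⟨L.sz, R.sz⟩, ⟨L.nn, R.nn⟩⟩, ⟨h1, h2⟩, ⟨L, R⟩, ⟨?_, ?_⟩, rfl⟩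
            · exact (hF _ (by dsimp only; omega) _ _).2 ⟨rfl, rfl⟩
            · exact (hF _ (by dsimp only; omega) _ _).2 ⟨rfl, rfl⟩
        have hGc : G.card = catalan (r + 1) * (n + 1).choose (2 * r + 1) := by
          rw [Finset.card_biUnion]
          · have : ∀ x ∈ Finset.HasAntidiagonal.antidiagonal n ×ˢ Finset.HasAntidiagonal.antidiagonal r,
              ((F x.1.1 x.2.1 ×ˢ F x.1.2 x.2.2).image (fun y => nd y.1 y.2)).card
              = (catalan x.2.1 * catalan x.2.2) * (x.1.1.choose (2 * x.2.1) * x.1.2.choose (2 * x.2.2)) := by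
              rintro ⟨⟨i, j⟩, ⟨s, u⟩⟩ hx
              simp only [Finset.mem_product, Finset.HasAntidiagonal.mem_antidiagonal] at hx
              rw [Finset.card_image_of_injective, Finset.card_product, hc _ (by dsimp only; omega), hc _ (by dsimp only; omega)]
              · ring
              · rintro ⟨a, b⟩ ⟨a', b'⟩ h
                simpa using h
            rw [Finset.sum_congr rfl this, Finset.sum_product_right]
            simp only [← Finset.mul_sum, choose_conv]
            rw [catalan_succ', Finset.sum_mul]
            apply Finset.sum_congr rfl
            rintro ⟨s, u⟩ hx
            simp only [Finset.HasAntidiagonal.mem_antidiagonal] at hx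
            subst hx
            simp only [mul_add]
          · rintro ⟨⟨i, j⟩, ⟨s, u⟩⟩ hx ⟨⟨i', j'⟩, ⟨s', u'⟩⟩ hx' hne
            simp only [Finset.coe_product, Set.mem_prod, Finset.mem_coe, Finset.mem_product, Finset.HasAntidiagonal.mem_antidiagonal] at hx hx'
            rw [Function.onFun, Finset.disjoint_left]
            intro t h1 h2
            apply hne
            simp only [Finset.mem_image, Finset.mem_product] at h1 h2
            obtain ⟨⟨L, R⟩, ⟨h3, h4⟩, rfl⟩ := h1
            obtain ⟨⟨L', R'⟩, ⟨h3', h4'⟩, h⟩ := h2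
            simp only [nd.injEq] at h
            obtain ⟨rfl, rfl⟩ := h
            rw [hF _ (by omega)] at h3 h4 h3' h4'
            simp only [Prod.mk.injEq]
            simp only at *
            omega
        refine ⟨(F (n + 1) (r + 1)).image c ∪ G, ?_, ?_⟩
        · intro t
          simp only [Finset.mem_union, hG, Finset.mem_image]
          cases t with
          | e => simp [sz]
          | c R => simp [sz, nn, hF]
          | nd L R =>
            simp [sz, nn]
            omega
        · rw [Finset.card_union_of_disjoint, hGc, Finset.card_image_of_injective _ (fun a b h => by simpa using h), hc _ (by omega)]
          · rw [show 2 * (r + 1) = 2 * r + 1 + 1 by ring, Nat.choose_succ_succ (n + 1)]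
            simp only [Nat.succ_eq_add_one]
            ring
          · rw [Finset.disjoint_left]
            intro t h1 h2
            simp only [Finset.mem_image] at h1
            obtain ⟨a, _, rfl⟩ := h1
            obtain ⟨L, R, h, _⟩ := (hG _).1 h2
            simp at h

end MTree

/-- Extension of a permutation of `Fin n` to a function on `ℕ`. -/
def extf {n : ℕ} (π : Equiv.Perm (Fin n)) (i : ℕ) : ℕ := if h : i < n then π ⟨i, h⟩ else 0

theorem extf_val {n : ℕ} (π : Equiv.Perm (Fin n)) (i : Fin n) : extf π i = π i := by
  simp [extf]

theorem extf_of_lt {n : ℕ} (π : Equiv.Perm (Fin n)) (i : ℕ) (h : i < n) : extf π i = π ⟨i, h⟩ := by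
  simp [extf, h]

theorem motzkin_iff {n : ℕ} (π : Equiv.Perm (Fin n)) : IsMotzkinPerm π ↔ Mz n (extf π) := by
  constructor
  · rintro ⟨h1, h2⟩
    constructor
    · rintro i j k ⟨hij, hjk, hk, a, b⟩
      rw [extf_of_lt π i (by omega), extf_of_lt π k (by omega)] at a
      rw [extf_of_lt π j (by omega), extf_of_lt π k (by omega)] at b
      exact h1 ⟨_, _, _, hij, hjk, a, b⟩
    · rintro x y ⟨hxy, hy, a, b⟩
      rw [extf_of_lt π x (by omega), extf_of_lt π y (by omega)] at a
      rw [extf_of_lt π y (by omega), extf_of_lt π (y + 1) (by omega)] at b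
      exact h2 ⟨_, ⟨y, by omega⟩, hy, hxy, a, b⟩
  · rintro ⟨h1, h2⟩
    constructor
    · rintro ⟨i, j, k, hij, hjk, a, b⟩
      refine h1 i j k ⟨hij, hjk, k.2, ?_, ?_⟩
      · simpa [extf_val] using a
      · simpa [extf_val] using b
    · rintro ⟨x, y, h, hxy, a, b⟩
      refine h2 x y ⟨hxy, h, ?_, ?_⟩
      · simpa [extf_val] using a
      · rw [extf_val, extf_of_lt π _ h]; exact b

theorem rises_eq {n : ℕ} (π : Equiv.Perm (Fin n)) : rises π = rs n (extf π) := by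
  classical
  unfold rises rs
  rw [Finset.sum_range, Nat.card_eq_fintype_card, Fintype.card_subtype, Finset.card_filter]
  apply Finset.sum_congr rfl
  intro i _
  refine if_congr ?_ rfl rfl
  constructor
  · rintro ⟨h, hh⟩
    refine ⟨h, ?_⟩
    rw [extf_val, extf_of_lt π _ h]; exact hh
  · rintro ⟨h, hh⟩
    refine ⟨h, ?_⟩
    rw [extf_val, extf_of_lt π _ h] at hh; exact hh

theorem rs_congr {n : ℕ} {f g : ℕ → ℕ} (h : ∀ i < n, f i = g i) : rs n f = rs n g := by
  unfold rs
  apply Finset.sum_congr rfl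
  intro i hi
  refine if_congr ?_ rfl rfl
  refine and_congr_right fun h' => ?_
  rw [h i (by omega), h (i + 1) h']

theorem mz_congr {n : ℕ} {f g : ℕ → ℕ} (h : ∀ i < n, f i = g i) (hf : Mz n f) : Mz n g := by
  constructor
  · rintro i j k ⟨h1, h2, h3, h4⟩
    rw [← h i (by omega), ← h j (by omega), ← h k (by omega)] at h4
    exact hf.1 i j k ⟨h1, h2, h3, h4⟩
  · rintro a b ⟨h1, h2, h3⟩
    rw [← h a (by omega), ← h b (by omega), ← h (b + 1) (by omega)] at h3
    exact hf.2 a b ⟨h1, h2, h3⟩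

theorem extf_inj {n : ℕ} {π σ : Equiv.Perm (Fin n)} (h : ∀ i < n, extf π i = extf σ i) : π = σ := by
  ext i
  rw [← extf_val, ← extf_val]
  exact h i i.2

/-- The permutation of a tree. -/
noncomputable def MTree.toPerm (t : MTree) (n : ℕ) (h : t.sz = n) : Equiv.Perm (Fin n) :=
  Equiv.ofBijective (fun i : Fin n => (⟨t.ev i, by have := t.ev_lt i; omega⟩ : Fin n))
    (Finite.injective_iff_bijective.1 (by
      intro i j hij
      simp only [Fin.mk.injEq] at hij
      exact Fin.ext (t.ev_inj i (by omega) j (by omega) hij)))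

theorem MTree.extf_toPerm (t : MTree) (n : ℕ) (h : t.sz = n) (i : ℕ) (hi : i < n) :
    extf (t.toPerm n h) i = t.ev i := by
  rw [extf_of_lt _ _ hi]
  simp [toPerm]

theorem card_motzkin (n r : ℕ) :
    Nat.card {π : Equiv.Perm (Fin n) // IsMotzkinPerm π ∧ rises π = r} =
      catalan r * n.choose (2 * r) := by
  obtain ⟨F, hF, hc⟩ := MTree.count n r
  rw [← hc]
  have h1 : Nat.card {t : MTree // t ∈ F} = F.card := by simp
  rw [← h1]
  symm
  let φ : {t : MTree // t ∈ F} → {π : Equiv.Perm (Fin n) // IsMotzkinPerm π ∧ rises π = r} :=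
    fun t => ⟨t.1.toPerm n ((hF _).1 t.2).1, by
      obtain ⟨h2, h3⟩ := (hF _).1 t.2
      have he := t.1.extf_toPerm n h2
      have hz := t.1.ev_mz
      have hr := t.1.ev_rs
      rw [h2] at hz hr
      exact ⟨(motzkin_iff _).2 (mz_congr (fun i hi => (he i hi).symm) hz), by
        rw [rises_eq, rs_congr he, hr, h3]⟩⟩
  apply Nat.card_congr (Equiv.ofBijective φ _)
  constructor
  · rintro ⟨t, ht⟩ ⟨u, hu⟩ h
    have h' : t.toPerm n ((hF _).1 ht).1 = u.toPerm n ((hF _).1 hu).1 := congrArg Subtype.val h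
    obtain ⟨h2, h3⟩ := (hF _).1 ht
    obtain ⟨h4, h5⟩ := (hF _).1 hu
    apply Subtype.ext
    apply MTree.ev_unique _ _ (h2.trans h4.symm)
    intro i hi
    rw [← t.extf_toPerm n h2 i (by omega), h', u.extf_toPerm n h4 i (by omega)]
  · rintro ⟨π, hm, hr⟩
    obtain ⟨t, ht, hte⟩ := MTree.ev_surj n (extf π)
      (fun i hi => by rw [extf_of_lt π i hi]; exact (π ⟨i, hi⟩).2)
      (fun i hi j hj h => by
        rw [extf_of_lt π i hi, extf_of_lt π j hj] at h
        simpa using π.injective (Fin.ext h)) ((motzkin_iff π).1 hm)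
    have hn : t.nn = r := by
      rw [← t.ev_rs, ht, rs_congr hte, ← rises_eq, hr]
    refine ⟨⟨t, (hF _).2 ⟨ht, hn⟩⟩, ?_⟩
    apply Subtype.ext
    apply extf_inj
    intro i hi
    rw [← hte i hi]
    exact t.extf_toPerm n ht i hi

theorem lds_part {n : ℕ} (π : Equiv.Perm (Fin n)) (hπ : IsMotzkinPerm π) : lds π + rises π = n := by
  classical
  obtain ⟨h132, h123⟩ := hπ
  let Q : Fin n → Prop := fun i => ∃ h : (i : ℕ) + 1 < n, π i < π ⟨(i : ℕ) + 1, h⟩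
  let S : Finset (Fin n) := Finset.univ.filter Q
  have hS : rises π = S.card := by
    unfold rises
    rw [Nat.card_eq_fintype_card, Fintype.card_subtype]
  let nx : Fin n → Fin n := fun i => if h : (i : ℕ) + 1 < n then ⟨i + 1, h⟩ else i
  have hnx : ∀ i ∈ S, ((nx i : Fin n) : ℕ) = i + 1 ∧ π i < π (nx i) := by
    intro i hi
    simp only [S, Q, Finset.mem_filter, Finset.mem_univ, true_and] at hi
    obtain ⟨h, hh⟩ := hi
    simp only [nx, dif_pos h]
    exact ⟨trivial, hh⟩
  have hcons : ∀ i ∈ S, nx i ∉ S := by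
    intro i hi hj
    obtain ⟨h1, h2⟩ := hnx i hi
    simp only [S, Q, Finset.mem_filter, Finset.mem_univ, true_and] at hj
    obtain ⟨h, hh⟩ := hj
    exact h123 ⟨i, nx i, h, by rw [Fin.lt_def]; omega, h2, hh⟩
  have hub : ∀ m ∈ {m : ℕ | ∃ f : Fin m → Fin n, StrictMono f ∧ StrictAnti fun i => π (f i)},
      m ≤ n - S.card := by
    rintro m ⟨f, hf, hfa⟩
    let I : Finset (Fin n) := Finset.univ.image f
    have hI : I.card = m := by
      rw [Finset.card_image_of_injective _ hf.injective]; simp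
    have hno : ∀ i ∈ S, i ∈ I → nx i ∉ I := by
      intro i hi h1 h2
      obtain ⟨h3, h4⟩ := hnx i hi
      simp only [I, Finset.mem_image, Finset.mem_univ, true_and] at h1 h2
      obtain ⟨a, rfl⟩ := h1
      obtain ⟨b, hb⟩ := h2
      have hab : a < b := by
        rw [← hf.lt_iff_lt, hb, Fin.lt_def]; omega
      have := hfa hab
      simp only [hb] at this
      exact absurd h4 (not_lt.2 this.le)
    have : S.card ≤ Iᶜ.card := by
      apply Finset.card_le_card_of_injOn (fun i => if i ∈ I then nx i else i)
      · intro i hi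
        simp only [Finset.coe_compl, Set.mem_compl_iff, Finset.mem_coe] at *
        split_ifs with h
        · exact hno i hi h
        · exact h
      · intro i hi j hj hij
        simp only [Finset.mem_coe] at hi hj hij
        split_ifs at hij
        · have h1 := (hnx i hi).1
          have h2 := (hnx j hj).1
          rw [hij] at h1
          exact Fin.ext (by omega)
        · exact absurd hj (hij ▸ hcons i hi)
        · exact absurd hi (hij ▸ hcons j hj)
        · exact hij
    rw [Finset.card_compl, Fintype.card_fin, hI] at this
    have h2 : I.card ≤ n := by simpa using Finset.card_le_univ I
    omega
  have hSn : S.card ≤ n := by simpa using Finset.card_le_univ S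
  have hmem : n - S.card ∈
      {m : ℕ | ∃ f : Fin m → Fin n, StrictMono f ∧ StrictAnti fun i => π (f i)} := by
    let T : Finset (Fin n) := (S.image nx)ᶜ
    have hT : T.card = n - S.card := by
      rw [Finset.card_compl, Fintype.card_fin, Finset.card_image_of_injOn]
      intro i hi j hj hij
      have h1 := (hnx i hi).1
      have h2 := (hnx j hj).1
      rw [hij] at h1
      exact Fin.ext (by omega)
    refine ⟨T.orderEmbOfFin hT, (T.orderEmbOfFin hT).strictMono, ?_⟩
    suffices key : ∀ i j : Fin n, i < j → j ∈ T → π j < π i from fun a b hab =>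
      key _ _ ((T.orderEmbOfFin hT).strictMono hab) (T.orderEmbOfFin_mem hT b)
    intro i j hlt hb
    by_contra hcon
    have hij : π i < π j := lt_of_le_of_ne (not_lt.1 hcon) (fun h => hlt.ne (π.injective h))
    rw [Fin.lt_def] at hlt
    let k : Fin n := ⟨j - 1, by omega⟩
    have hkj : (k : ℕ) + 1 = j := by simp only [k]; omega
    have hk : ¬ π k < π j := by
      intro h
      have e : (⟨(k : ℕ) + 1, by omega⟩ : Fin n) = j := Fin.ext hkj
      have hkS : k ∈ S := by
        simp only [S, Q, Finset.mem_filter, Finset.mem_univ, true_and]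
        exact ⟨by omega, by rw [e]; exact h⟩
      apply Finset.mem_compl.1 hb
      rw [Finset.mem_image]
      exact ⟨k, hkS, Fin.ext (by rw [(hnx k hkS).1, hkj])⟩
    have hik : i ≠ k := fun h => hk (h ▸ hij)
    have hik' : (i : ℕ) ≠ k := fun h => hik (Fin.ext h)
    refine h132 ⟨i, k, j, by rw [Fin.lt_def]; omega, by rw [Fin.lt_def]; omega, hij, ?_⟩
    refine lt_of_le_of_ne (not_lt.1 hk) (fun h => ?_)
    have := π.injective h
    rw [this] at hkj
    omega
  have : lds π = n - S.card := le_antisymm (csSup_le ⟨_, hmem⟩ hub) (le_csSup ⟨_, hub⟩ hmem)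
  rw [this, hS]
  omega

/-- For any Motzkin permutation of length `n` one has `lds + #rises = n`, and the number of
Motzkin permutations of length `n` with exactly `r` rises is
`(1/(r+1)) * choose (2r) r * choose n (2r)`. -/
theorem lds_add_rises_and_count (n : ℕ) :
    (∀ π : Equiv.Perm (Fin n), IsMotzkinPerm π → lds π + rises π = n) ∧
    (∀ r : ℕ,
      Nat.card {π : Equiv.Perm (Fin n) // IsMotzkinPerm π ∧ rises π = r} * (r + 1) =
        Nat.choose (2 * r) r * Nat.choose n (2 * r)) := by
  refine ⟨fun π hπ => lds_part π hπ, fun r => ?_⟩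
  rw [card_motzkin, mul_right_comm, mul_comm (catalan r), succ_mul_catalan_eq_centralBinom,
    Nat.centralBinom]
end

section
/- For every k ≥ 2, N_{12…k}(x)·q_{k−1}(x) = q_{k−2}(x), where N_{12…k}(x) = Σ_{n≥0} |𝔐_n(12…k)| x^n is the generating function for Motzkin permutations avoiding the pattern 12…k (equivalently, having no increasing subsequence of length k). Equivalently, N_{12…k}(x) = U_{k−2}((1−x)/(2x)) / (x·U_{k−1}((1−x)/(2x))). -/
/-- `π` has an increasing subsequence of length `k`, i.e. contains the pattern `12…k`. -/
def HasIncr (k : ℕ) {n : ℕ} (π : Equiv.Perm (Fin n)) : Prop :=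
  ∃ f : Fin k → Fin n, StrictMono f ∧ StrictMono fun i => π (f i)

/-- `qcheb r` is the polynomial `q_{r-1}`, where `q_{-1} = 0`, `q_0 = 1` and
`q_{r+1} = (1-x) q_r - x² q_{r-1}`; equivalently `q_r(x) = x^r U_r((1-x)/(2x))`. -/
noncomputable def qcheb : ℕ → PowerSeries ℚ
  | 0 => 0
  | 1 => 1
  | (r + 2) => (1 - PowerSeries.X) * qcheb (r + 1) - PowerSeries.X ^ 2 * qcheb r


/-- List version of 132 avoidance. -/
def LAv132 : List ℕ → Prop
  | [] => True
  | a :: t => t.Pairwise (fun b c => ¬ (a < c ∧ c < b)) ∧ LAv132 t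

/-- List version of 1-23 avoidance. -/
def LAv123 : List ℕ → Prop
  | [] => True
  | a :: t => t.IsChain (fun b c => ¬ (a < b ∧ b < c)) ∧ LAv123 t

/-- No increasing sublist of length `k`, and `2 ≤ k`. -/
def LNoInc (k : ℕ) (l : List ℕ) : Prop :=
  2 ≤ k ∧ ∀ s : List ℕ, s.Sublist l → s.Pairwise (· < ·) → s.length < k

theorem LAv132_append (l₁ l₂ : List ℕ) : LAv132 (l₁ ++ l₂) ↔
    LAv132 l₁ ∧ LAv132 l₂ ∧ (∀ a ∈ l₁, l₂.Pairwise (fun b c => ¬ (a < c ∧ c < b))) ∧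
      (∀ c ∈ l₂, l₁.Pairwise (fun a b => ¬ (a < c ∧ c < b))) := by
  induction l₁ with
  | nil => simp [LAv132]
  | cons a t ih =>
    simp only [List.cons_append, LAv132, ih, List.pairwise_append, List.pairwise_cons,
      List.mem_cons]
    constructor
    · rintro ⟨⟨h1, h2, h3⟩, h4, h5, h6, h7⟩
      refine ⟨⟨h1, h4⟩, h5, ?_, ?_⟩
      · rintro b (rfl | hb)
        · exact h2
        · exact h6 b hb
      · exact fun c hc => ⟨fun b hb => h3 b hb c hc, h7 c hc⟩
    · rintro ⟨⟨h1, h4⟩, h5, h6, h7⟩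
      exact ⟨⟨h1, h6 a (Or.inl rfl), fun b hb c hc => (h7 c hc).1 b hb⟩, h4, h5,
        fun b hb => h6 b (Or.inr hb), fun c hc => (h7 c hc).2⟩

theorem LAv123_append (l₁ l₂ : List ℕ) : LAv123 (l₁ ++ l₂) ↔
    LAv123 l₁ ∧ LAv123 l₂ ∧ (∀ a ∈ l₁, l₂.IsChain (fun b c => ¬ (a < b ∧ b < c))) ∧
      (∀ a ∈ l₁, ∀ x ∈ l₁.getLast?, ∀ y ∈ l₂.head?, ¬ (a < x ∧ x < y)) := by
  induction l₁ with
  | nil => simp [LAv123]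
  | cons a t ih =>
    simp only [List.cons_append, LAv123, ih, List.isChain_append, List.mem_cons]
    rcases List.eq_nil_or_concat t with rfl | ⟨u, v, rfl⟩
    · simp [LAv123]
      tauto
    · rw [List.concat_eq_append, ← List.cons_append, List.getLast?_concat, List.getLast?_concat]
      constructor
      · rintro ⟨⟨h1, h2, h3⟩, h4, h5, h6, h7⟩
        refine ⟨⟨h1, h4⟩, h5, ?_, ?_⟩
        · rintro b (rfl | hb)
          · exact h2
          · exact h6 b hb
        · rintro b (rfl | hb)
          · exact h3
          · exact h7 b hb
      · rintro ⟨⟨h1, h4⟩, h5, h6, h7⟩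
        exact ⟨⟨h1, h6 a (Or.inl rfl), h7 a (Or.inl rfl)⟩, h4, h5,
          fun b hb => h6 b (Or.inr hb), fun b hb => h7 b (Or.inr hb)⟩

theorem LAv132_ofFn {n : ℕ} (f : Fin n → ℕ) : LAv132 (List.ofFn f) ↔
    ∀ i j k, i < j → j < k → ¬ (f i < f k ∧ f k < f j) := by
  induction n with
  | zero => simp [LAv132]
  | succ n ih =>
    simp only [List.ofFn_succ, LAv132, ih, List.pairwise_ofFn]
    constructor
    · rintro ⟨h1, h2⟩ i j k hij hjk
      obtain ⟨j, rfl⟩ := Fin.exists_succ_eq.2 (Fin.ne_zero_of_lt hij)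
      obtain ⟨k, rfl⟩ := Fin.exists_succ_eq.2 (Fin.ne_zero_of_lt hjk)
      cases i using Fin.cases with
      | zero => exact h1 (Fin.succ_lt_succ_iff.1 hjk)
      | succ i => exact h2 i j k (Fin.succ_lt_succ_iff.1 hij) (Fin.succ_lt_succ_iff.1 hjk)
    · intro h
      exact ⟨fun j k hjk => h 0 j.succ k.succ (Fin.succ_pos _) (Fin.succ_lt_succ_iff.2 hjk),
        fun i j k hij hjk => h _ _ _ (Fin.succ_lt_succ_iff.2 hij) (Fin.succ_lt_succ_iff.2 hjk)⟩

theorem LAv123_ofFn {n : ℕ} (f : Fin n → ℕ) : LAv123 (List.ofFn f) ↔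
    ∀ (a b : Fin n) (h : (b : ℕ) + 1 < n), a < b → ¬ (f a < f b ∧ f b < f ⟨(b : ℕ) + 1, h⟩) := by
  induction n with
  | zero => simp [LAv123]
  | succ n ih =>
    simp only [List.ofFn_succ, LAv123, ih, List.isChain_ofFn]
    constructor
    · rintro ⟨h1, h2⟩ a b h hab
      obtain ⟨b, rfl⟩ := Fin.exists_succ_eq.2 (Fin.ne_zero_of_lt hab)
      simp only [Fin.val_succ] at h
      cases a using Fin.cases with
      | zero => exact h1 b (by omega)
      | succ a => exact h2 a b (by omega) (Fin.succ_lt_succ_iff.1 hab)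
    · intro h
      refine ⟨fun b hb => ?_, fun a b hb hab => ?_⟩
      · exact h 0 (Fin.succ ⟨b, by omega⟩) (by simp; omega) (Fin.succ_pos _)
      · exact h a.succ b.succ (by simp; omega) (Fin.succ_lt_succ_iff.2 hab)

theorem LNoInc_ofFn {n : ℕ} (k : ℕ) (hk : 2 ≤ k) (π : Equiv.Perm (Fin n)) :
    LNoInc k (List.ofFn fun i => (π i : ℕ)) ↔ ¬ HasIncr k π := by
  constructor
  · rintro ⟨-, h⟩ ⟨f, hf, hg⟩
    have := h (List.ofFn fun i => (π (f i) : ℕ)) ?_ ?_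
    · simp at this
    · rw [List.sublist_iff_exists_fin_orderEmbedding_get_eq]
      refine ⟨OrderEmbedding.ofStrictMono (fun i => Fin.cast (by simp) (f (Fin.cast (by simp) i))) ?_, ?_⟩
      · intro i j hij
        exact hf (show Fin.cast _ i < Fin.cast _ j from hij)
      · intro i
        simp
        rfl
    · rw [List.pairwise_ofFn]
      exact fun i j hij => hg hij
  · intro h
    refine ⟨hk, fun s hs hp => ?_⟩
    by_contra hlt
    push Not at hlt
    rw [List.sublist_iff_exists_fin_orderEmbedding_get_eq] at hs
    obtain ⟨f, hf⟩ := hs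
    apply h
    refine ⟨fun i => Fin.cast (by simp) (f (Fin.castLE hlt i)), ?_, ?_⟩
    · intro i j hij
      exact f.strictMono (show Fin.castLE hlt i < Fin.castLE hlt j from hij)
    · intro i j hij
      have h1 := hf (Fin.castLE hlt i)
      have h2 := hf (Fin.castLE hlt j)
      have h3 := List.pairwise_iff_get.1 hp (Fin.castLE hlt i) (Fin.castLE hlt j) hij
      rw [h1, h2] at h3
      simp only [List.get_ofFn] at h3
      exact h3

open Classical in
/-- Motzkin words on the values `s, …, s+n-1` without increasing sublist of length `k`. -/
noncomputable def GF (s n k : ℕ) : Finset (List ℕ) :=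
  (List.range' s n).permutations.toFinset.filter fun l => LAv132 l ∧ LAv123 l ∧ LNoInc k l

theorem mem_GF {s n k : ℕ} {l : List ℕ} : l ∈ GF s n k ↔
    (l.Nodup ∧ ∀ x, x ∈ l ↔ s ≤ x ∧ x < s + n) ∧ LAv132 l ∧ LAv123 l ∧ LNoInc k l := by
  classical
  simp only [GF, Finset.mem_filter, List.mem_toFinset, List.mem_permutations]
  refine and_congr_left fun _ => ?_
  constructor
  · intro h
    refine ⟨h.nodup_iff.2 List.nodup_range', fun x => ?_⟩
    rw [h.mem_iff, List.mem_range'_1]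
  · rintro ⟨h1, h2⟩
    rw [List.perm_ext_iff_of_nodup h1 List.nodup_range']
    intro x
    rw [h2, List.mem_range'_1]

theorem GF_bridge (k : ℕ) (hk : 2 ≤ k) (n : ℕ) :
    Nat.card {π : Equiv.Perm (Fin n) // IsMotzkinPerm π ∧ ¬ HasIncr k π} = (GF 0 n k).card := by
  classical
  rw [Nat.card_eq_fintype_card, Fintype.card_subtype]
  have key : ∀ π : Equiv.Perm (Fin n), (IsMotzkinPerm π ∧ ¬ HasIncr k π) ↔
      (LAv132 (List.ofFn fun i => (π i : ℕ)) ∧ LAv123 (List.ofFn fun i => (π i : ℕ)) ∧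
        LNoInc k (List.ofFn fun i => (π i : ℕ))) := by
    intro π
    rw [LNoInc_ofFn k hk, LAv132_ofFn, LAv123_ofFn, IsMotzkinPerm, Avoids132, Avoids1_23]
    push Not
    rw [and_assoc]
    rfl
  refine Finset.card_bij (fun π _ => List.ofFn fun i => (π i : ℕ)) ?_ ?_ ?_
  · intro π hπ
    rw [Finset.mem_filter] at hπ
    rw [mem_GF]
    refine ⟨⟨?_, ?_⟩, (key π).1 hπ.2⟩
    · rw [List.nodup_ofFn]
      exact Fin.val_injective.comp π.injective
    · intro x
      rw [List.mem_ofFn']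
      simp only [Set.mem_range, Nat.zero_le, true_and, Nat.zero_add]
      constructor
      · rintro ⟨i, rfl⟩
        exact (π i).2
      · intro hx
        exact ⟨π.symm ⟨x, hx⟩, by simp⟩
  · intro π _ ρ _ h
    have := List.ofFn_injective h
    ext i
    exact congrFun this i
  · intro l hl
    rw [mem_GF] at hl
    obtain ⟨⟨h1, h2⟩, h3⟩ := hl
    have hlen : l.length = n := by
      have : l.Perm (List.range n) := by
        rw [List.perm_ext_iff_of_nodup h1 List.nodup_range]
        intro x
        rw [h2]; simp
      simpa using this.length_eq
    subst hlen
    let f : Fin l.length → Fin l.length := fun i => ⟨l.get i, by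
      have := (h2 (l.get i)).1 (List.get_mem _ _)
      omega⟩
    have hf : Function.Injective f := by
      intro i j hij
      exact List.nodup_iff_injective_get.1 h1 (Fin.mk.inj_iff.1 hij)
    have hl : (List.ofFn fun i => ((Equiv.ofBijective f (Finite.injective_iff_bijective.1 hf)) i : ℕ)) = l :=
      List.ofFn_get l
    refine ⟨Equiv.ofBijective f (Finite.injective_iff_bijective.1 hf), ?_, hl⟩
    rw [Finset.mem_filter]
    refine ⟨Finset.mem_univ _, ?_⟩
    rw [key, hl]
    exact h3

theorem pw_of_mem {R : ℕ → ℕ → Prop} {l : List ℕ} (h : ∀ a ∈ l, ∀ b ∈ l, R a b) :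
    l.Pairwise R := by
  induction l with
  | nil => simp
  | cons x l ih =>
    rw [List.pairwise_cons]
    exact ⟨fun b hb => h x (by simp) b (by simp [hb]),
      ih fun a ha b hb => h a (by simp [ha]) b (by simp [hb])⟩

theorem LNoInc.sublist {k : ℕ} {l l' : List ℕ} (h : LNoInc k l) (hs : l'.Sublist l) :
    LNoInc k l' := ⟨h.1, fun s h1 h2 => h.2 s (h1.trans hs) h2⟩

/-- Structure of good words, backward direction, first form. -/
theorem GF_cons {s n k : ℕ} {t : List ℕ} (h : t ∈ GF s n k) : (s + n) :: t ∈ GF s (n + 1) k := by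
  rw [mem_GF] at h ⊢
  obtain ⟨⟨h1, h2⟩, h3, h4, h5⟩ := h
  refine ⟨⟨?_, ?_⟩, ⟨?_, h3⟩, ⟨?_, h4⟩, h5.1, ?_⟩
  · rw [List.nodup_cons, h2]
    exact ⟨by omega, h1⟩
  · intro x
    rw [List.mem_cons, h2]
    omega
  · refine pw_of_mem ?_
    intro b hb c hc
    rw [h2] at hb hc
    omega
  · refine List.Pairwise.isChain (pw_of_mem ?_)
    intro b hb c hc
    rw [h2] at hb hc
    omega
  · intro u hu hp
    rw [List.sublist_cons_iff] at hu
    rcases hu with hu | ⟨r, rfl, hr⟩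
    · exact h5.2 u hu hp
    · cases r with
      | nil => have := h5.1; simp; omega
      | cons y r =>
        have hy := (h2 y).1 (hr.subset (by simp))
        have := (List.pairwise_cons.1 hp).1 y (by simp)
        omega

/-- Structure of good words, backward direction, second form. -/
theorem GF_join {s i j k : ℕ} {σ t : List ℕ} (hσ : σ ∈ GF (s + j + 1) i k)
    (ht : t ∈ GF s j (k + 1)) :
    σ ++ (s + j) :: (s + (i + j + 1)) :: t ∈ GF s (i + j + 2) (k + 1) := by
  rw [mem_GF] at hσ ht ⊢
  obtain ⟨⟨a1, a2⟩, a3, a4, a5⟩ := hσ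
  obtain ⟨⟨b1, b2⟩, b3, b4, b5⟩ := ht
  refine ⟨⟨?_, ?_⟩, ?_, ?_, ?_⟩
  · rw [List.nodup_append]
    refine ⟨a1, ?_, ?_⟩
    · simp only [List.nodup_cons, List.mem_cons, b2]
      exact ⟨by omega, by omega, b1⟩
    · intro x hx y hy
      simp only [List.mem_cons, b2] at hy
      rw [a2] at hx
      omega
  · intro x
    simp only [List.mem_append, List.mem_cons, a2, b2]
    omega
  · rw [LAv132_append]
    refine ⟨a3, ⟨?_, ?_, b3⟩, ?_, ?_⟩
    · rw [List.pairwise_cons]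
      refine ⟨fun c hc => ?_, pw_of_mem fun b hb c hc => ?_⟩
      · rw [b2] at hc; omega
      · rw [b2] at hb hc; omega
    · refine pw_of_mem fun b hb c hc => ?_
      rw [b2] at hb hc; omega
    · intro a ha
      rw [a2] at ha
      simp only [List.pairwise_cons, List.mem_cons]
      refine ⟨?_, ?_, pw_of_mem fun b hb c hc => ?_⟩
      · intro c hc
        rw [b2] at hc; omega
      · intro c hc
        rw [b2] at hc; omega
      · rw [b2] at hb hc; omega
    · intro c hc
      simp only [List.mem_cons, b2] at hc
      refine pw_of_mem fun a ha b hb => ?_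
      rw [a2] at ha hb
      omega
  · rw [LAv123_append]
    refine ⟨a4, ⟨?_, ?_, b4⟩, ?_, ?_⟩
    · refine List.Pairwise.isChain (List.pairwise_cons.2 ⟨fun c hc => ?_, 
        pw_of_mem fun b hb c hc => ?_⟩)
      · rw [b2] at hc; omega
      · rw [b2] at hb hc; omega
    · refine List.Pairwise.isChain (pw_of_mem fun b hb c hc => ?_)
      rw [b2] at hb hc; omega
    · intro a ha
      rw [a2] at ha
      refine List.Pairwise.isChain ?_
      simp only [List.pairwise_cons, List.mem_cons]
      refine ⟨?_, ?_, pw_of_mem fun b hb c hc => ?_⟩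
      · intro c hc
        rw [b2] at hc; omega
      · intro c hc
        rw [b2] at hc; omega
      · rw [b2] at hb hc; omega
    · intro a ha x hx y hy
      simp only [List.head?_cons, Option.mem_some_iff] at hy
      have hx' := List.mem_of_getLast? hx
      rw [a2] at hx'
      omega
  · refine ⟨b5.1, fun u hu hp => ?_⟩
    have hk := a5.1
    rw [List.sublist_append_iff] at hu
    obtain ⟨p, q, rfl, hp1, hq⟩ := hu
    rw [List.pairwise_append] at hp
    obtain ⟨pp, pq, ppq⟩ := hp
    have hpl := a5.2 p hp1 pp
    have hpm : ∀ x ∈ p, s + j + 1 ≤ x := fun x hx => ((a2 x).1 (hp1.subset hx)).1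
    -- the contribution of `m :: t`
    have hm : ∀ r : List ℕ, r.Sublist ((s + (i + j + 1)) :: t) → r.Pairwise (· < ·) →
        (∀ z, s + j ≤ z → (∀ y ∈ r, z < y) → r.length ≤ 1) ∧ r.length < k + 1 := by
      intro r hr hrp
      rw [List.sublist_cons_iff] at hr
      rcases hr with hr | ⟨r, rfl, hr⟩
      · refine ⟨fun z hz hzy => ?_, b5.2 r hr hrp⟩
        cases r with
        | nil => simp
        | cons y r =>
          have := (b2 y).1 (hr.subset (by simp))
          have := hzy y (by simp)
          omega
      · cases r with
        | nil => simp; omega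
        | cons y r =>
          have hy := (b2 y).1 (hr.subset (by simp))
          have := (List.pairwise_cons.1 hrp).1 y (by simp)
          omega
    rw [List.length_append]
    rw [List.sublist_cons_iff] at hq
    rcases hq with hq | ⟨r, rfl, hr⟩
    · cases p with
      | nil => simpa using (hm q hq pq).2
      | cons x p =>
        have := (hm q hq pq).1 x (by have := hpm x (by simp); omega) (ppq x (by simp))
        omega
    · cases p with
      | nil =>
        rw [List.pairwise_cons] at pq
        have := (hm r hr pq.2).1 (s + j) le_rfl pq.1
        simp
        omega
      | cons x p =>
        have h1 := ppq x (by simp) (s + j) (by simp)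
        have h2 := hpm x (by simp)
        omega

/-- Structure of good words, forward direction. -/
theorem GF_split {s n k : ℕ} {l : List ℕ} (h : l ∈ GF s (n + 2) (k + 1)) :
    (∃ t ∈ GF s (n + 1) (k + 1), l = (s + (n + 1)) :: t) ∨
    ∃ i j, i + j = n ∧ ∃ σ ∈ GF (s + j + 1) i k, ∃ t ∈ GF s j (k + 1),
      l = σ ++ (s + j) :: (s + (n + 1)) :: t := by
  rw [mem_GF] at h
  obtain ⟨⟨h1, h2⟩, h3, h4, h5⟩ := h
  have hm : s + (n + 1) ∈ l := by rw [h2]; omega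
  obtain ⟨l₁, t, rfl⟩ := List.append_of_mem hm
  rcases List.eq_nil_or_concat l₁ with rfl | ⟨σ, v, rfl⟩
  · left
    refine ⟨t, ?_, rfl⟩
    rw [mem_GF]
    simp only [List.nil_append, List.nodup_cons, List.mem_cons] at h1 h2
    refine ⟨⟨h1.2, fun x => ?_⟩, h3.2, h4.2, h5.sublist (by simp)⟩
    constructor
    · intro hx
      have := (h2 x).1 (Or.inr hx)
      have : x ≠ s + (n + 1) := fun e => h1.1 (e ▸ hx)
      omega
    · intro hx
      have := (h2 x).2 (by omega)
      rcases this with h | h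
      · omega
      · exact h
  · right
    simp only [List.concat_eq_append, List.append_assoc, List.cons_append, List.nil_append] at *
    rw [LAv132_append] at h3
    rw [LAv123_append] at h4
    obtain ⟨c1, ⟨c2, c3, c4⟩, c5, c6⟩ := h3
    obtain ⟨d1, ⟨d2, d3, d4⟩, d5, d6⟩ := h4
    simp only [List.nodup_append, List.nodup_cons, List.mem_cons] at h1
    obtain ⟨n1, ⟨n2, n3, n4⟩, n5⟩ := h1
    simp only [List.mem_append, List.mem_cons] at h2
    have ev := (h2 v).1 (by simp)
    have vm : v ≠ s + (n + 1) := fun e => n2 (Or.inl e)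
    have tv : ∀ x ∈ t, x < v := by
      intro x hx
      have e1 := (List.pairwise_cons.1 c2).1 x hx
      have e2 : v ≠ x := fun e => n2 (Or.inr (e ▸ hx))
      have e3 : x ≠ s + (n + 1) := fun e => n3 (e ▸ hx)
      have := (h2 x).1 (by simp [hx])
      omega
    have sv : ∀ x ∈ σ, v < x ∧ x < s + (n + 1) := by
      intro x hx
      have e1 := d5 x hx
      rw [List.isChain_cons_cons] at e1
      have e2 := n5 x hx v (by simp)
      have e3 := n5 x hx (s + (n + 1)) (by simp)
      have := (h2 x).1 (by simp [hx])
      omega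
    obtain ⟨j, rfl⟩ := Nat.exists_eq_add_of_le ev.1
    obtain ⟨i, rfl⟩ : ∃ i, n = i + j := ⟨n - j, by omega⟩
    refine ⟨i, j, rfl, σ, ?_, t, ?_, rfl⟩
    · rw [mem_GF]
      refine ⟨⟨n1, fun x => ⟨fun hx => ?_, fun hx => ?_⟩⟩, c1, d1, ?_, ?_⟩
      · have := sv x hx
        omega
      · rcases (h2 x).2 (by omega) with h | h | h | h
        · exact h
        · omega
        · omega
        · have := tv x h
          omega
      · have := h5.2 [s + j, s + (i + j + 1)] ?_ ?_
        · simp at this; omega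
        · refine List.Sublist.trans ?_ (List.sublist_append_right _ _)
          simp
        · simp
      · intro u hu hp
        have := h5.2 (u ++ [s + (i + j + 1)]) ?_ ?_
        · simp at this; omega
        · refine List.Sublist.append hu ?_
          simp
        · rw [List.pairwise_append]
          refine ⟨hp, by simp, fun x hx y hy => ?_⟩
          rw [List.mem_singleton] at hy
          subst hy
          exact (sv x (hu.subset hx)).2
    · rw [mem_GF]
      refine ⟨⟨n4, fun x => ⟨fun hx => ?_, fun hx => ?_⟩⟩, c4, d4, h5.sublist ?_⟩
      · have := tv x hx
        have := (h2 x).1 (by simp [hx])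
        omega
      · rcases (h2 x).2 (by omega) with h | h | h | h
        · have := sv x h
          omega
        · omega
        · omega
        · exact h
      · refine List.Sublist.trans ?_ (List.sublist_append_right _ _)
        exact (List.sublist_cons_self _ _).trans (List.sublist_cons_self _ _)

theorem split_inj {m : ℕ} {a b c d : List ℕ} (ha : m ∉ a) (hc : m ∉ c)
    (h : a ++ m :: b = c ++ m :: d) : a = c ∧ b = d := by
  induction a generalizing c with
  | nil =>
    cases c with
    | nil => simpa using h
    | cons x c => simp at h hc; omega
  | cons y a ih =>
    cases c with
    | nil => simp at h ha; omega
    | cons x c =>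
      simp only [List.cons_append, List.cons.injEq] at h
      have := ih (fun h => ha (by simp [h])) (fun h => hc (by simp [h])) h.2
      simp [h.1, this]

theorem join_inj {s i j i' j' k k' m : ℕ} (hij : s + i + j + 1 = m) (hij' : s + i' + j' + 1 = m)
    {σ t σ' t' : List ℕ} (hσ : σ ∈ GF (s + j + 1) i k) (hσ' : σ' ∈ GF (s + j' + 1) i' k')
    (h : σ ++ (s + j) :: m :: t = σ' ++ (s + j') :: m :: t') : j = j' ∧ σ = σ' ∧ t = t' := by
  rw [mem_GF] at hσ hσ'
  have e : ∀ (u : List ℕ) (x : ℕ) (w : List ℕ), u ++ x :: m :: w = (u ++ [x]) ++ m :: w := by simp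
  rw [e, e] at h
  obtain ⟨h1, h2⟩ := split_inj (by simp [hσ.1.2]; omega) (by simp [hσ'.1.2]; omega) h
  rw [List.append_inj' h1 rfl |>.1] 
  have := (List.append_inj' h1 rfl).2
  simp at this
  exact ⟨this, rfl, h2⟩

theorem GF_rec (s n k : ℕ) : (GF s (n + 2) (k + 1)).card =
    (GF s (n + 1) (k + 1)).card +
      ∑ p ∈ Finset.HasAntidiagonal.antidiagonal n, (GF (s + p.2 + 1) p.1 k).card * (GF s p.2 (k + 1)).card := by
  classical
  have hU : GF s (n + 2) (k + 1) =
      (GF s (n + 1) (k + 1)).image (fun t => (s + (n + 1)) :: t) ∪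
      (Finset.HasAntidiagonal.antidiagonal n).biUnion (fun p =>
        (GF (s + p.2 + 1) p.1 k ×ˢ GF s p.2 (k + 1)).image
          (fun q => q.1 ++ (s + p.2) :: (s + (n + 1)) :: q.2)) := by
    ext l
    simp only [Finset.mem_union, Finset.mem_image, Finset.mem_biUnion, Finset.mem_product,
      Finset.HasAntidiagonal.mem_antidiagonal, Prod.exists]
    constructor
    · intro h
      rcases GF_split h with ⟨t, ht, rfl⟩ | ⟨i, j, hij, σ, hσ, t, ht, rfl⟩
      · exact Or.inl ⟨t, ht, rfl⟩
      · exact Or.inr ⟨i, j, hij, σ, t, ⟨hσ, ht⟩, rfl⟩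
    · rintro (⟨t, ht, rfl⟩ | ⟨i, j, rfl, σ, t, ⟨hσ, ht⟩, rfl⟩)
      · exact GF_cons ht
      · exact GF_join hσ ht
  rw [hU, Finset.card_union_of_disjoint, Finset.card_image_of_injective, Finset.card_biUnion]
  · congr 1
    refine Finset.sum_congr rfl fun p hp => ?_
    rw [Finset.card_image_of_injOn, Finset.card_product]
    rw [Finset.HasAntidiagonal.mem_antidiagonal] at hp
    rintro ⟨σ, t⟩ h1 ⟨σ', t'⟩ h2 h
    simp only [Finset.coe_product, Set.mem_prod, Finset.mem_coe] at h1 h2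
    have := join_inj (by omega) (by omega) h1.1 h2.1 h
    exact Prod.ext this.2.1 this.2.2
  · intro p hp p' hp' hne
    rw [Finset.mem_coe, Finset.HasAntidiagonal.mem_antidiagonal] at hp hp'
    rw [Function.onFun, Finset.disjoint_left]
    intro l hl hl'
    simp only [Finset.mem_image, Finset.mem_product] at hl hl'
    obtain ⟨q, hq, rfl⟩ := hl
    obtain ⟨q', hq', h⟩ := hl'
    have := (join_inj (by omega) (by omega) hq.1 hq'.1 h.symm).1
    apply hne
    ext <;> omega
  · intro t t' h
    simpa using h
  · rw [Finset.disjoint_left]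
    intro l hl hl'
    simp only [Finset.mem_image, Finset.mem_biUnion, Finset.mem_product,
      Finset.HasAntidiagonal.mem_antidiagonal] at hl hl'
    obtain ⟨t, ht, rfl⟩ := hl
    obtain ⟨p, hp, q, hq, h⟩ := hl'
    have e : q.1 ++ (s + p.2) :: (s + (n + 1)) :: q.2 =
      (q.1 ++ [s + p.2]) ++ (s + (n + 1)) :: q.2 := by simp
    rw [e] at h
    have hσ := mem_GF.1 hq.1
    have := (split_inj (c := []) (by simp [hσ.1.2]; omega) (by simp) h).1
    simp at this

theorem GF_one_card (s n : ℕ) (k : ℕ) (hk : k ≤ 1) : (GF s n k).card = 0 := by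
  rw [Finset.card_eq_zero, Finset.eq_empty_iff_forall_notMem]
  intro l hl
  have := (mem_GF.1 hl).2.2.2.1
  omega

theorem GF_n0 (s k : ℕ) (hk : 2 ≤ k) : (GF s 0 k).card = 1 := by
  rw [Finset.card_eq_one]
  refine ⟨[], ?_⟩
  ext l
  rw [mem_GF, Finset.mem_singleton]
  constructor
  · intro h
    rw [List.eq_nil_iff_forall_not_mem]
    intro x hx
    have := (h.1.2 x).1 hx
    omega
  · rintro rfl
    refine ⟨⟨by simp, fun x => by simp⟩, trivial, trivial, hk, ?_⟩
    intro u hu _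
    simp at hu
    simp [hu]; omega

theorem GF_n1 (s k : ℕ) (hk : 2 ≤ k) : (GF s 1 k).card = 1 := by
  have h0 : ([] : List ℕ) ∈ GF s 0 k := by
    obtain ⟨a, ha⟩ := Finset.card_eq_one.1 (GF_n0 s k hk)
    have ha' : a ∈ GF s 0 k := by rw [ha]; simp
    have : a = [] := by
      rw [List.eq_nil_iff_forall_not_mem]
      intro x hx
      have := ((mem_GF.1 ha').1.2 x).1 hx
      omega
    exact this ▸ ha'
  rw [Finset.card_eq_one]
  refine ⟨[s], ?_⟩
  ext l
  rw [Finset.mem_singleton]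
  constructor
  · intro h
    rw [mem_GF] at h
    have : l.Perm [s] := by
      rw [List.perm_ext_iff_of_nodup h.1.1 (by simp)]
      intro x
      rw [h.1.2]
      simp
      omega
    exact List.perm_singleton.1 this
  · rintro rfl
    exact GF_cons h0

theorem GF_shift (n : ℕ) : ∀ s k, (GF s n k).card = (GF 0 n k).card := by
  induction n using Nat.strong_induction_on with
  | _ n ih =>
    intro s k
    rcases Nat.lt_or_ge k 2 with hk | hk
    · rw [GF_one_card _ _ _ (by omega), GF_one_card _ _ _ (by omega)]
    · match n, ih with
      | 0, _ => rw [GF_n0 _ _ hk, GF_n0 _ _ hk]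
      | 1, _ => rw [GF_n1 _ _ hk, GF_n1 _ _ hk]
      | n + 2, ih =>
        obtain ⟨k, rfl⟩ : ∃ j, k = j + 1 := ⟨k - 1, by omega⟩
        rw [GF_rec, GF_rec, ih (n + 1) (by omega)]
        congr 1
        refine Finset.sum_congr rfl fun p hp => ?_
        rw [Finset.HasAntidiagonal.mem_antidiagonal] at hp
        rw [ih p.1 (by omega), ih p.2 (by omega) s, ih p.1 (by omega) (0 + p.2 + 1)]

/-- Generating function of good words. -/
noncomputable def Ngf (k : ℕ) : PowerSeries ℚ := PowerSeries.mk fun n => ((GF 0 n k).card : ℚ)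

theorem Ngf_rec (k : ℕ) (hk : 1 ≤ k) : Ngf (k + 1) =
    1 + PowerSeries.X * Ngf (k + 1) + PowerSeries.X ^ 2 * (Ngf k * Ngf (k + 1)) := by
  have e : (PowerSeries.X : PowerSeries ℚ) ^ 2 * (Ngf k * Ngf (k + 1)) =
    PowerSeries.X * (PowerSeries.X * (Ngf k * Ngf (k + 1))) := by ring
  rw [e]
  ext n
  match n with
  | 0 => simp [Ngf, GF_n0 0 (k + 1) (by omega)]
  | 1 =>
    rw [show (1 : ℕ) = 0 + 1 from rfl, map_add, map_add, PowerSeries.coeff_succ_X_mul,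
      PowerSeries.coeff_succ_X_mul]
    simp [Ngf, GF_n0 0 (k + 1) (by omega), GF_n1 0 (k + 1) (by omega), PowerSeries.coeff_one]
  | n + 2 =>
    rw [map_add, map_add, PowerSeries.coeff_succ_X_mul, PowerSeries.coeff_succ_X_mul,
      PowerSeries.coeff_succ_X_mul, PowerSeries.coeff_mul, PowerSeries.coeff_one]
    simp only [Ngf, PowerSeries.coeff_mk]
    rw [GF_rec]
    push_cast
    simp [GF_shift _ (_ + 1)]

theorem Ngf_eq (k : ℕ) : Ngf (k + 1) * qcheb (k + 1) = qcheb k := by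
  induction k with
  | zero =>
    have : Ngf (0 + 1) = 0 := by
      ext n
      simp [Ngf, GF_one_card]
    rw [this, zero_mul, qcheb]
  | succ k ih =>
    have h := Ngf_rec (k + 1) (by omega)
    rw [qcheb, ← ih]
    linear_combination qcheb (k + 1) * h

/-- `N_{12…k}(x) q_{k-1}(x) = q_{k-2}(x)`, i.e.
`N_{12…k}(x) = U_{k-2}((1-x)/(2x)) / (x U_{k-1}((1-x)/(2x)))`. -/
theorem N_avoid_incr_eq (k : ℕ) (hk : 2 ≤ k) :
    (PowerSeries.mk fun n =>
        (Nat.card {π : Equiv.Perm (Fin n) // IsMotzkinPerm π ∧ ¬ HasIncr k π} : ℚ)) *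
      qcheb k = qcheb (k - 1) := by
  obtain ⟨k, rfl⟩ : ∃ j, k = j + 1 := ⟨k - 1, by omega⟩
  rw [← show Ngf (k + 1) = _ from congrArg PowerSeries.mk (funext fun n => by
    rw [GF_bridge _ hk])]
  exact Ngf_eq k
end

section
/- Let N(x_1,x_2,x_3,…) = Σ_{n≥0} Σ_{π∈𝔐_n} Π_{j≥1} x_j^{c_j(π)}, where c_j(π) is the number of occurrences of the pattern 12…j in π (the number of increasing subsequences of length j), a well-defined formal power series in the countably many variables x_1, x_2, … (each permutation contributes a monomial in finitely many variables since c_j(π)=0 for j > n, and c_1(π)=n). Then N satisfies the functional equation N(x_1,x_2,x_3,…) = 1 + x_1·N(x_1,x_2,x_3,…) + x_1²x_2·N(x_1x_2, x_2x_3, x_3x_4, …)·N(x_1,x_2,x_3,…), where N(x_1x_2, x_2x_3, …) is obtained from N by substituting x_j x_{j+1} for x_j for every j ≥ 1. -/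
/-- `nIncr j π` is the number of occurrences of the pattern `12…j` in `π`, i.e. the
number of increasing subsequences of length `j`. -/
noncomputable def nIncr (j : ℕ) {n : ℕ} (π : Equiv.Perm (Fin n)) : ℕ :=
  Nat.card {f : Fin j → Fin n // StrictMono f ∧ StrictMono fun i => π (f i)}

/-- The generating function `N(x₁,x₂,…) = ∑_n ∑_{π ∈ 𝔐_n} ∏_{j ≥ 1} x_j ^ (# of 12…j in π)`,
as a formal power series in countably many variables, where the variable of index `j : ℕ`
stands for `x_{j+1}`. -/
noncomputable def Ngen : MvPowerSeries ℕ ℚ :=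
  fun m : ℕ →₀ ℕ =>
    (Nat.card {p : Σ n : ℕ, Equiv.Perm (Fin n) //
      IsMotzkinPerm p.2 ∧ ∀ j : ℕ, nIncr (j + 1) p.2 = m j} : ℚ)

/-- The series `N(x₁x₂, x₂x₃, x₃x₄, …)` obtained from `N` by substituting `x_j x_{j+1}`
for `x_j` for every `j ≥ 1`: the exponent of `x_1` in the monomial of `π` is `c_1(π)` and the
exponent of `x_{j+1}` (variable of index `j ≥ 1`) is `c_j(π) + c_{j+1}(π)`. -/
noncomputable def NgenSub : MvPowerSeries ℕ ℚ :=
  fun m : ℕ →₀ ℕ =>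
    (Nat.card {p : Σ n : ℕ, Equiv.Perm (Fin n) //
      IsMotzkinPerm p.2 ∧ nIncr 1 p.2 = m 0 ∧
      ∀ j : ℕ, 1 ≤ j → nIncr j p.2 + nIncr (j + 1) p.2 = m j} : ℚ)


/-! ### Generating functions of weighted types -/

/-- generating function of a weight. -/
noncomputable def wGF {T : Type} (w : T → (ℕ →₀ ℕ)) : MvPowerSeries ℕ ℚ :=
  fun m => (Nat.card {t : T // w t = m} : ℚ)

lemma coeff_wGF {T : Type} (w : T → (ℕ →₀ ℕ)) (m : ℕ →₀ ℕ) :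
    MvPowerSeries.coeff m (wGF w) = (Nat.card {t : T // w t = m} : ℚ) := rfl

lemma wGF_congr {S T : Type} (e : S ≃ T) (v : S → (ℕ →₀ ℕ)) (w : T → (ℕ →₀ ℕ))
    (h : ∀ s, w (e s) = v s) : wGF w = wGF v := by
  ext m
  rw [coeff_wGF, coeff_wGF]
  congr 1
  exact (Nat.card_congr (e.subtypeEquiv (fun s => by rw [h]))).symm

lemma wGF_sum {S T : Type} (v : S → (ℕ →₀ ℕ)) (w : T → (ℕ →₀ ℕ))
    (hv : ∀ m, Finite {s // v s = m}) (hw : ∀ m, Finite {s // w s = m}) :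
    wGF (Sum.elim v w) = wGF v + wGF w := by
  ext m
  rw [map_add, coeff_wGF, coeff_wGF, coeff_wGF]
  have : Finite {a // Sum.elim v w (Sum.inl a) = m} := hv m
  have : Finite {a // Sum.elim v w (Sum.inr a) = m} := hw m
  rw [Nat.card_congr (Equiv.subtypeSum), Nat.card_sum]
  push_cast
  rfl

lemma wGF_unit : wGF (fun _ : Unit => (0 : ℕ →₀ ℕ)) = 1 := by
  classical
  ext m
  rw [coeff_wGF, MvPowerSeries.coeff_one]
  split_ifs with h
  · subst h; simp
  · have : IsEmpty {t : Unit // (0 : ℕ →₀ ℕ) = m} := ⟨fun t => h t.2.symm⟩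
    simp

lemma wGF_prod {S T : Type} (v : S → (ℕ →₀ ℕ)) (w : T → (ℕ →₀ ℕ))
    (hv : ∀ m, Finite {s // v s = m}) (hw : ∀ m, Finite {s // w s = m}) :
    wGF (fun p : S × T => v p.1 + w p.2) = wGF v * wGF w := by
  classical
  ext m
  rw [MvPowerSeries.coeff_mul, coeff_wGF]
  simp only [coeff_wGF]
  have e : {p : S × T // v p.1 + w p.2 = m} ≃
      Σ ab : {ab // ab ∈ Finset.HasAntidiagonal.antidiagonal m}, {s // v s = ab.1.1} × {t // w t = ab.1.2} :=
    { toFun := fun p => ⟨⟨(v p.1.1, w p.1.2), by simpa using p.2⟩, ⟨p.1.1, rfl⟩, ⟨p.1.2, rfl⟩⟩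
      invFun := fun q => ⟨(q.2.1.1, q.2.2.1), by
        have := q.1.2
        rw [q.2.1.2, q.2.2.2]; exact Finset.HasAntidiagonal.mem_antidiagonal.1 this⟩
      left_inv := fun p => rfl
      right_inv := by
        rintro ⟨⟨⟨a, b⟩, h⟩, ⟨s, hs⟩, ⟨t, ht⟩⟩
        dsimp at hs ht
        subst hs ht
        rfl }
  rw [Nat.card_congr e, Nat.card_sigma]
  push_cast
  rw [Finset.sum_coe_sort (Finset.HasAntidiagonal.antidiagonal m) (fun ab =>
    (Nat.card ({s // v s = ab.1} × {t // w t = ab.2}) : ℚ))]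
  simp [Nat.card_prod]

lemma wGF_shift {T : Type} (w : T → (ℕ →₀ ℕ)) (d : ℕ →₀ ℕ) :
    wGF (fun t => d + w t) = MvPowerSeries.monomial d 1 * wGF w := by
  classical
  ext m
  rw [MvPowerSeries.coeff_monomial_mul, coeff_wGF]
  split_ifs with h
  · rw [coeff_wGF, one_mul]
    congr 1
    refine Nat.card_congr (Equiv.subtypeEquivRight fun t => ?_)
    constructor
    · intro h; rw [← h]; simp
    · intro h'; rw [h']; exact add_tsub_cancel_of_le h
  · have : IsEmpty {t : T // d + w t = m} := ⟨fun t => h (t.2 ▸ le_self_add)⟩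
    simp

/-! ### Skew sum and adding a new maximum at the end -/

/-- skew sum -/
def skew {a b : ℕ} (σ : Equiv.Perm (Fin a)) (τ : Equiv.Perm (Fin b)) : Equiv.Perm (Fin (a + b)) :=
  ((finSumFinEquiv.symm.trans (Equiv.sumCongr σ τ)).trans (Equiv.sumComm _ _)).trans
    (finSumFinEquiv.trans (finCongr (Nat.add_comm b a)))

lemma skew_left {a b : ℕ} (σ : Equiv.Perm (Fin a)) (τ : Equiv.Perm (Fin b)) (i : Fin a) :
    ((skew σ τ (Fin.castAdd b i) : Fin (a + b)) : ℕ) = b + σ i := by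
  simp [skew, add_comm]

lemma skew_right {a b : ℕ} (σ : Equiv.Perm (Fin a)) (τ : Equiv.Perm (Fin b)) (i : Fin b) :
    ((skew σ τ (Fin.natAdd a i) : Fin (a + b)) : ℕ) = τ i := by
  simp [skew]

/-- append a new maximum -/
def addMax {a : ℕ} (σ : Equiv.Perm (Fin a)) : Equiv.Perm (Fin (a + 1)) :=
  (finSuccEquivLast.trans (Equiv.optionCongr σ)).trans finSuccEquivLast.symm

lemma addMax_castSucc {a : ℕ} (σ : Equiv.Perm (Fin a)) (i : Fin a) :
    addMax σ i.castSucc = (σ i).castSucc := by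
  simp [addMax]

lemma addMax_last {a : ℕ} (σ : Equiv.Perm (Fin a)) :
    addMax σ (Fin.last a) = Fin.last a := by
  simp [addMax]

lemma skew_lt {a b : ℕ} (σ : Equiv.Perm (Fin a)) (τ : Equiv.Perm (Fin b)) (i : Fin a)
    (j : Fin b) : skew σ τ (Fin.natAdd a j) < skew σ τ (Fin.castAdd b i) := by
  rw [Fin.lt_def, skew_left, skew_right]; omega

lemma skew_lt_left {a b : ℕ} (σ : Equiv.Perm (Fin a)) (τ : Equiv.Perm (Fin b)) (i j : Fin a) :
    skew σ τ (Fin.castAdd b i) < skew σ τ (Fin.castAdd b j) ↔ σ i < σ j := by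
  rw [Fin.lt_def, skew_left, skew_left, Fin.lt_def]; omega

lemma skew_lt_right {a b : ℕ} (σ : Equiv.Perm (Fin a)) (τ : Equiv.Perm (Fin b)) (i j : Fin b) :
    skew σ τ (Fin.natAdd a i) < skew σ τ (Fin.natAdd a j) ↔ τ i < τ j := by
  rw [Fin.lt_def, skew_right, skew_right, Fin.lt_def]

lemma natAdd_lt' {a b : ℕ} (i j : Fin b) : Fin.natAdd a i < Fin.natAdd a j ↔ i < j := by
  simp only [Fin.lt_def, Fin.val_natAdd]; omega

lemma castAdd_lt' {a b : ℕ} (i j : Fin a) : Fin.castAdd b i < Fin.castAdd b j ↔ i < j := by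
  simp only [Fin.lt_def, Fin.val_castAdd]

lemma not_natAdd_lt_castAdd {a b : ℕ} (i : Fin b) (j : Fin a) :
    ¬ Fin.natAdd a i < Fin.castAdd b j := by
  simp only [Fin.lt_def, Fin.val_natAdd, Fin.val_castAdd]; omega

/-- A form of `Avoids1_23` that is convenient to use. -/
lemma avoids1_23_iff {n : ℕ} (π : Equiv.Perm (Fin n)) :
    Avoids1_23 π ↔ ∀ a b c : Fin n, (c : ℕ) = b + 1 → a < b → π a < π b → π b < π c → False := by
  constructor
  · rintro h a b c hc hab h1 h2
    refine h ⟨a, b, by omega, hab, h1, ?_⟩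
    have : (⟨(b : ℕ) + 1, by omega⟩ : Fin n) = c := Fin.ext hc.symm
    rwa [this]
  · rintro h ⟨a, b, hb, hab, h1, h2⟩
    exact h a b _ rfl hab h1 h2

lemma avoids132_iff {n : ℕ} (π : Equiv.Perm (Fin n)) :
    Avoids132 π ↔ ∀ i j k : Fin n, i < j → j < k → π i < π k → π k < π j → False := by
  constructor
  · exact fun h i j k h1 h2 h3 h4 => h ⟨i, j, k, h1, h2, h3, h4⟩
  · rintro h ⟨i, j, k, h1, h2, h3, h4⟩
    exact h i j k h1 h2 h3 h4

lemma motzkin_skew {a b : ℕ} (σ : Equiv.Perm (Fin a)) (τ : Equiv.Perm (Fin b)) :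
    IsMotzkinPerm (skew σ τ) ↔ IsMotzkinPerm σ ∧ IsMotzkinPerm τ := by
  simp only [IsMotzkinPerm, avoids1_23_iff, avoids132_iff]
  constructor
  · rintro ⟨h1, h2⟩
    refine ⟨⟨fun i j k hij hjk h h' => h1 (Fin.castAdd b i) (Fin.castAdd b j) (Fin.castAdd b k)
        hij hjk ((skew_lt_left ..).2 h) ((skew_lt_left ..).2 h'), 
      fun i j k hij hjk h h' => h2 (Fin.castAdd b i) (Fin.castAdd b j) (Fin.castAdd b k)
        hij hjk ((skew_lt_left ..).2 h) ((skew_lt_left ..).2 h')⟩, 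
      fun i j k hij hjk h h' => h1 (Fin.natAdd a i) (Fin.natAdd a j) (Fin.natAdd a k)
        ((natAdd_lt' ..).2 hij) ((natAdd_lt' ..).2 hjk)
        ((skew_lt_right ..).2 h) ((skew_lt_right ..).2 h'), 
      fun i j k hij hjk h h' => h2 (Fin.natAdd a i) (Fin.natAdd a j) (Fin.natAdd a k)
        (by simp only [Fin.val_natAdd]; omega) ((natAdd_lt' ..).2 hjk)
        ((skew_lt_right ..).2 h) ((skew_lt_right ..).2 h')⟩
  · rintro ⟨⟨h1, h2⟩, h3, h4⟩
    constructor
    · intro i j k hij hjk h h'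
      induction i using Fin.addCases with
      | left i =>
        induction k using Fin.addCases with
        | left k =>
          induction j using Fin.addCases with
          | left j => exact h1 i j k hij hjk ((skew_lt_left ..).1 h) ((skew_lt_left ..).1 h')
          | right j => exact not_natAdd_lt_castAdd _ _ hjk
        | right k => exact absurd h (not_lt_of_gt (skew_lt ..))
      | right i =>
        induction j using Fin.addCases with
        | left j => exact not_natAdd_lt_castAdd _ _ hij
        | right j =>
          induction k using Fin.addCases with
          | left k => exact not_natAdd_lt_castAdd _ _ hjk
          | right k => exact h3 i j k ((natAdd_lt' ..).1 hij) ((natAdd_lt' ..).1 hjk)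
                        ((skew_lt_right ..).1 h) ((skew_lt_right ..).1 h')
    · intro i j k hjk hij h h'
      have hjk' : j < k := by rw [Fin.lt_def]; omega
      induction i using Fin.addCases with
      | left i =>
        induction j using Fin.addCases with
        | left j =>
          induction k using Fin.addCases with
          | left k => exact h2 i j k hjk hij ((skew_lt_left ..).1 h) ((skew_lt_left ..).1 h')
          | right k => exact absurd h' (not_lt_of_gt (skew_lt ..))
        | right j => exact absurd h (not_lt_of_gt (skew_lt ..))
      | right i =>
        induction j using Fin.addCases with
        | left j => exact not_natAdd_lt_castAdd _ _ hij
        | right j =>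
          induction k using Fin.addCases with
          | left k => exact not_natAdd_lt_castAdd _ _ hjk'
          | right k => exact h4 i j k (by simp only [Fin.val_natAdd] at hjk; omega)
                        ((natAdd_lt' ..).1 hij)
                        ((skew_lt_right ..).1 h) ((skew_lt_right ..).1 h')

lemma motzkin_one (σ : Equiv.Perm (Fin 1)) : IsMotzkinPerm σ := by
  simp only [IsMotzkinPerm, avoids1_23_iff, avoids132_iff]
  constructor
  · intro i j k h; omega
  · intro i j k h h'; omega

lemma motzkin_zero (σ : Equiv.Perm (Fin 0)) : IsMotzkinPerm σ := by
  simp only [IsMotzkinPerm, avoids1_23_iff, avoids132_iff]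
  exact ⟨fun i => i.elim0, fun i => i.elim0⟩

lemma motzkin_addMax {a : ℕ} (σ : Equiv.Perm (Fin a)) :
    IsMotzkinPerm (addMax σ) ↔
      IsMotzkinPerm σ ∧ ∀ i j : Fin a, (j : ℕ) + 1 = a → i < j → σ j < σ i := by
  simp only [IsMotzkinPerm, avoids1_23_iff, avoids132_iff]
  constructor
  · rintro ⟨h1, h2⟩
    refine ⟨⟨fun i j k hij hjk h h' => h1 i.castSucc j.castSucc k.castSucc hij hjk ?_ ?_, 
      fun i j k hij hjk h h' => h2 i.castSucc j.castSucc k.castSucc hij hjk ?_ ?_⟩, ?_⟩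
    · simpa [addMax_castSucc] using h
    · simpa [addMax_castSucc] using h'
    · simpa [addMax_castSucc] using h
    · simpa [addMax_castSucc] using h'
    · intro i j hj hij
      by_contra hcon
      have hne : σ i ≠ σ j := fun h => hij.ne (σ.injective h)
      have hlt : σ i < σ j := lt_of_le_of_ne (not_lt.1 hcon) hne
      refine h2 i.castSucc j.castSucc (Fin.last a) (by simp [hj]) hij ?_ ?_
      · simpa [addMax_castSucc] using hlt
      · rw [addMax_last, addMax_castSucc]; exact Fin.castSucc_lt_last _
  · rintro ⟨⟨h1, h2⟩, h3⟩
    constructor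
    · intro i j k hij hjk h h'
      induction k using Fin.lastCases with
      | last => rw [addMax_last] at h'; exact absurd h' (not_lt_of_ge (Fin.le_last _))
      | cast k =>
        induction j using Fin.lastCases with
        | last => exact absurd hjk (not_lt_of_ge (Fin.le_last _))
        | cast j =>
          induction i using Fin.lastCases with
          | last => exact absurd hij (not_lt_of_ge (Fin.le_last _))
          | cast i =>
            simp only [addMax_castSucc, Fin.castSucc_lt_castSucc_iff] at *
            exact h1 i j k hij hjk h h'
    · intro i j k hjk hij h h'
      induction i using Fin.lastCases with
      | last => exact absurd hij (not_lt_of_ge (Fin.le_last _))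
      | cast i =>
        induction j using Fin.lastCases with
        | last => have := k.2; simp at hjk; omega
        | cast j =>
          induction k using Fin.lastCases with
          | last =>
            simp only [addMax_castSucc, Fin.castSucc_lt_castSucc_iff] at *
            refine absurd h (not_lt_of_gt (h3 i j ?_ hij))
            simp at hjk; omega
          | cast k =>
            simp only [addMax_castSucc, Fin.castSucc_lt_castSucc_iff] at *
            exact h2 i j k hjk hij h h'

/-! ### Counting increasing subsequences -/

lemma nIncr_skew {a b : ℕ} (σ : Equiv.Perm (Fin a)) (τ : Equiv.Perm (Fin b)) (j : ℕ) :
    nIncr (j + 1) (skew σ τ) = nIncr (j + 1) σ + nIncr (j + 1) τ := by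
  unfold nIncr
  rw [← Nat.card_sum]
  symm
  refine Nat.card_congr (Equiv.ofBijective (Sum.elim
    (fun f => ⟨fun i => Fin.castAdd b (f.1 i), fun x y h => f.2.1 h,
      fun x y h => (skew_lt_left ..).2 (f.2.2 h)⟩)
    (fun f => ⟨fun i => Fin.natAdd a (f.1 i), fun x y h => (natAdd_lt' ..).2 (f.2.1 h),
      fun x y h => (skew_lt_right ..).2 (f.2.2 h)⟩)) ⟨?_, ?_⟩)
  · rintro (f | f) (g | g) h
    · simp only [Sum.elim_inl, Subtype.mk.injEq] at h
      congr 1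
      ext i
      have := congrArg Fin.val (congrFun h i)
      simpa using this
    · simp only [Sum.elim_inl, Sum.elim_inr, Subtype.mk.injEq] at h
      have := congrArg Fin.val (congrFun h 0)
      simp at this
      omega
    · simp only [Sum.elim_inl, Sum.elim_inr, Subtype.mk.injEq] at h
      have := congrArg Fin.val (congrFun h 0)
      simp at this
      omega
    · simp only [Sum.elim_inr, Subtype.mk.injEq] at h
      congr 1
      ext i
      have := congrArg Fin.val (congrFun h i)
      simpa using this
  · rintro ⟨f, hf, hf'⟩
    by_cases h0 : (f 0 : ℕ) < a
    · have hall : ∀ i, (f i : ℕ) < a := by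
        intro i
        by_contra hi
        have hne : 0 < i := by
          rw [Fin.pos_iff_ne_zero]; rintro rfl; exact hi h0
        have hlt := hf' hne
        have e0 : f 0 = Fin.castAdd b ⟨f 0, h0⟩ := rfl
        have e1 : f i = Fin.natAdd a ⟨f i - a, by omega⟩ := by ext; simp; omega
        dsimp only at hlt
        rw [e0, e1] at hlt
        exact absurd hlt (not_lt_of_gt (skew_lt ..))
      refine ⟨Sum.inl ⟨fun i => ⟨f i, hall i⟩, fun x y h => hf h, fun x y h => ?_⟩, rfl⟩
      exact (skew_lt_left σ τ _ _).1 (hf' h)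
    · have hall : ∀ i, a ≤ (f i : ℕ) := by
        intro i
        have := hf.monotone (Fin.zero_le i)
        rw [Fin.le_def] at this
        omega
      have e1 : ∀ i, f i = Fin.natAdd a ⟨f i - a, by have := hall i; omega⟩ := by
        intro i; have := hall i; ext; simp; omega
      refine ⟨Sum.inr ⟨fun i => ⟨f i - a, by have := hall i; omega⟩, fun x y h => ?_, 
        fun x y h => ?_⟩, ?_⟩
      · rw [← natAdd_lt' (a := a), ← e1, ← e1]; exact hf h
      · have := hf' h
        dsimp only at this ⊢
        rw [e1 x, e1 y] at this
        exact (skew_lt_right σ τ _ _).1 this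
      · simp only [Sum.elim_inr, Subtype.mk.injEq]
        funext i
        exact (e1 i).symm

lemma nIncr_addMax {a : ℕ} (σ : Equiv.Perm (Fin a)) (j : ℕ) :
    nIncr (j + 1) (addMax σ) = nIncr (j + 1) σ + nIncr j σ := by
  unfold nIncr
  rw [← Nat.card_sum]
  symm
  refine Nat.card_congr (Equiv.ofBijective (Sum.elim
    (fun f => ⟨fun i => (f.1 i).castSucc, fun x y h => f.2.1 h,
      fun x y h => by simpa [addMax_castSucc] using f.2.2 h⟩)
    (fun f => ⟨Fin.snoc (α := fun _ => Fin (a + 1)) (fun i => (f.1 i).castSucc) (Fin.last a),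
      ?_, ?_⟩)) ⟨?_, ?_⟩)
  · intro x y h
    induction x using Fin.lastCases with
    | last => exact absurd h (not_lt_of_ge (Fin.le_last _))
    | cast x =>
      induction y using Fin.lastCases with
      | last => simp [Fin.castSucc_lt_last]
      | cast y => simpa using f.2.1 (by simpa using h)
  · intro x y h
    induction x using Fin.lastCases with
    | last => exact absurd h (not_lt_of_ge (Fin.le_last _))
    | cast x =>
      induction y using Fin.lastCases with
      | last => simp [addMax_castSucc, addMax_last, Fin.castSucc_lt_last]
      | cast y => simpa [addMax_castSucc] using f.2.2 (by simpa using h)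
  · rintro (f | f) (g | g) h
    · simp only [Sum.elim_inl, Subtype.mk.injEq] at h
      congr 1
      ext i
      have := congrArg Fin.val (congrFun h i)
      simpa using this
    · simp only [Sum.elim_inl, Sum.elim_inr, Subtype.mk.injEq] at h
      have := congrArg Fin.val (congrFun h (Fin.last _))
      simp at this
      omega
    · simp only [Sum.elim_inl, Sum.elim_inr, Subtype.mk.injEq] at h
      have := congrArg Fin.val (congrFun h (Fin.last _))
      simp at this
      omega
    · simp only [Sum.elim_inr, Subtype.mk.injEq] at h
      congr 1
      ext i
      have := congrArg Fin.val (congrFun h i.castSucc)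
      simpa using this
  · rintro ⟨f, hf, hf'⟩
    by_cases h0 : f (Fin.last j) = Fin.last a
    · have hall : ∀ i : Fin j, (f i.castSucc : ℕ) < a := by
        intro i
        have := hf (Fin.castSucc_lt_last i)
        rw [h0, Fin.lt_def] at this
        simpa using this
      refine ⟨Sum.inr ⟨fun i => ⟨f i.castSucc, hall i⟩, fun x y h => ?_, fun x y h => ?_⟩, ?_⟩
      · exact hf (Fin.castSucc_lt_castSucc_iff.2 h)
      · have := hf' (Fin.castSucc_lt_castSucc_iff.2 h)
        rw [← Fin.castSucc_lt_castSucc_iff, ← addMax_castSucc, ← addMax_castSucc]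
        exact this
      · simp only [Sum.elim_inr, Subtype.mk.injEq]
        funext i
        induction i using Fin.lastCases with
        | last => simp [h0]
        | cast i => simp
    · have hall : ∀ i, (f i : ℕ) < a := by
        intro i
        have h1 := hf.monotone (Fin.le_last i)
        have h2 : f (Fin.last j) < Fin.last a := Fin.lt_last_iff_ne_last.2 h0
        exact lt_of_le_of_lt h1 h2
      refine ⟨Sum.inl ⟨fun i => ⟨f i, hall i⟩, fun x y h => hf h, fun x y h => ?_⟩, rfl⟩
      rw [← Fin.castSucc_lt_castSucc_iff, ← addMax_castSucc, ← addMax_castSucc]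
      exact hf' h

lemma nIncr_zero {n : ℕ} (π : Equiv.Perm (Fin n)) : nIncr 0 π = 1 := by
  unfold nIncr
  rw [Nat.card_eq_one_iff_unique]
  refine ⟨⟨fun f g => Subtype.ext (funext fun i => i.elim0)⟩,
    ⟨⟨fun i => i.elim0, fun i => i.elim0, fun i => i.elim0⟩⟩⟩

lemma nIncr_one {n : ℕ} (π : Equiv.Perm (Fin n)) : nIncr 1 π = n := by
  unfold nIncr
  have : Nat.card (Fin n) = n := by simp
  conv_rhs => rw [← this]
  refine Nat.card_congr ⟨fun f => f.1 0, fun i => ⟨fun _ => i, ?_, ?_⟩, ?_, ?_⟩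
  · intro x y h; omega
  · intro x y h; omega
  · intro f; ext i; simp [Subsingleton.elim i 0]
  · intro f; rfl

lemma nIncr_big {n : ℕ} (π : Equiv.Perm (Fin n)) (j : ℕ) (h : n < j) : nIncr j π = 0 := by
  unfold nIncr
  have : IsEmpty {f : Fin j → Fin n // StrictMono f ∧ StrictMono fun i => π (f i)} := by
    refine ⟨fun f => ?_⟩
    have := Fintype.card_le_of_injective f.1 f.2.1.injective
    simp at this
    omega
  simp

/-! ### The type of Motzkin permutations and its decomposition -/

/-- Motzkin permutations of any length. -/
abbrev MT : Type := {p : Σ n : ℕ, Equiv.Perm (Fin n) // IsMotzkinPerm p.2}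

/-- the weight -/
noncomputable def wt (t : MT) : ℕ →₀ ℕ :=
  Finsupp.onFinset (Finset.range t.1.1) (fun j => nIncr (j + 1) t.1.2) (by
    intro j hj
    by_contra hcon
    exact hj (nIncr_big _ _ (by simp at hcon; omega)))

@[simp] lemma wt_apply (t : MT) (j : ℕ) : wt t j = nIncr (j + 1) t.1.2 := rfl

/-- the weight after substitution -/
noncomputable def wt' (t : MT) : ℕ →₀ ℕ :=
  wt t + Finsupp.mapDomain Nat.succ (wt t)

lemma wt'_zero (t : MT) : wt' t 0 = nIncr 1 t.1.2 := by
  have : Finsupp.mapDomain Nat.succ (wt t) 0 = 0 := by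
    apply Finsupp.mapDomain_of_notMem_range
    simp
  simp [wt', this]

lemma wt'_succ (t : MT) (j : ℕ) :
    wt' t (j + 1) = nIncr (j + 1) t.1.2 + nIncr (j + 1 + 1) t.1.2 := by
  have : Finsupp.mapDomain Nat.succ (wt t) (j + 1) = wt t j :=
    Finsupp.mapDomain_apply Nat.succ_injective _ _
  simp [wt', this, add_comm]

lemma finite_size (n : ℕ) : Finite {t : MT // t.1.1 = n} := by
  refine Finite.of_surjective
    (α := {σ : Equiv.Perm (Fin n) // IsMotzkinPerm σ}) (fun σ => ⟨⟨⟨n, σ.1⟩, σ.2⟩, rfl⟩) ?_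
  rintro ⟨⟨⟨k, σ⟩, h⟩, rfl⟩
  exact ⟨⟨σ, h⟩, rfl⟩

lemma wt_fin (m : ℕ →₀ ℕ) : Finite {t : MT // wt t = m} := by
  have := finite_size (m 0)
  refine Finite.of_injective (β := {t : MT // t.1.1 = m 0})
    (fun t => ⟨t.1, by have := DFunLike.congr_fun t.2 0; rwa [wt_apply, nIncr_one] at this⟩) ?_
  intro s t h
  simp only [Subtype.mk.injEq] at h
  exact Subtype.ext h

lemma wt'_fin (m : ℕ →₀ ℕ) : Finite {t : MT // wt' t = m} := by
  have := finite_size (m 0)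
  refine Finite.of_injective (β := {t : MT // t.1.1 = m 0})
    (fun t => ⟨t.1, by have := DFunLike.congr_fun t.2 0; rwa [wt'_zero, nIncr_one] at this⟩) ?_
  intro s t h
  simp only [Subtype.mk.injEq] at h
  exact Subtype.ext h

lemma Ngen_eq : Ngen = wGF wt := by
  funext m
  unfold Ngen wGF
  congr 1
  refine Nat.card_congr ((Equiv.subtypeSubtypeEquivSubtypeInter _ _).symm.trans
    (Equiv.subtypeEquivRight fun t => ?_))
  rw [DFunLike.ext_iff]; rfl

lemma NgenSub_eq : NgenSub = wGF wt' := by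
  funext m
  unfold NgenSub wGF
  congr 1
  refine Nat.card_congr ((Equiv.subtypeSubtypeEquivSubtypeInter _ (fun p : Σ n : ℕ,
      Equiv.Perm (Fin n) => nIncr 1 p.2 = m 0 ∧
      ∀ j : ℕ, 1 ≤ j → nIncr j p.2 + nIncr (j + 1) p.2 = m j)).symm.trans
    (Equiv.subtypeEquivRight fun t => ?_))
  rw [DFunLike.ext_iff (f := wt' t)]
  constructor
  · rintro ⟨h1, h2⟩ (_ | j)
    · rw [wt'_zero, h1]
    · rw [wt'_succ, h2 (j + 1) (by omega)]
  · intro h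
    refine ⟨by rw [← h, wt'_zero], ?_⟩
    rintro (_ | j) hj
    · omega
    · rw [← h, wt'_succ]

/-- the constructor of the second kind -/
def mkOne (t : MT) : MT :=
  ⟨⟨1 + t.1.1, skew (Equiv.refl (Fin 1)) t.1.2⟩, (motzkin_skew _ _).2 ⟨motzkin_one _, t.2⟩⟩

/-- the first block -/
def blk {a : ℕ} (σ : Equiv.Perm (Fin a)) : Equiv.Perm (Fin (a + 1 + 1)) :=
  addMax (skew σ (Equiv.refl (Fin 1)))

lemma motzkin_blk {a : ℕ} (σ : Equiv.Perm (Fin a)) (h : IsMotzkinPerm σ) :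
    IsMotzkinPerm (blk σ) := by
  refine (motzkin_addMax _).2 ⟨(motzkin_skew _ _).2 ⟨h, motzkin_one _⟩, ?_⟩
  intro i j hj hij
  induction i using Fin.addCases with
  | right i => simp [Fin.lt_def] at hij; omega
  | left i =>
    induction j using Fin.addCases with
    | left j => simp at hj; omega
    | right j => exact skew_lt ..

/-- the constructor of the third kind -/
def mkTwo (p : MT × MT) : MT :=
  ⟨⟨p.1.1.1 + 1 + 1 + p.2.1.1, skew (blk p.1.1.2) p.2.1.2⟩,
    (motzkin_skew _ _).2 ⟨motzkin_blk _ p.1.2, p.2.2⟩⟩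

/-- the empty permutation -/
def mkZero : MT := ⟨⟨0, Equiv.refl _⟩, motzkin_zero _⟩

/-- all constructors together -/
def mkAll : Unit ⊕ (MT ⊕ (MT × MT)) → MT :=
  Sum.elim (fun _ => mkZero) (Sum.elim mkOne mkTwo)

lemma nIncr_refl_one (j : ℕ) : nIncr (j + 1) (Equiv.refl (Fin 1)) = if j = 0 then 1 else 0 := by
  split_ifs with h
  · subst h; exact nIncr_one _
  · exact nIncr_big _ _ (by omega)

lemma wt_mkZero : wt mkZero = 0 := by
  ext j
  exact nIncr_big _ _ (by simp [mkZero])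

lemma wt_mkOne (t : MT) : wt (mkOne t) = Finsupp.single 0 1 + wt t := by
  ext j
  rw [Finsupp.add_apply, wt_apply, wt_apply]
  unfold mkOne
  dsimp only
  rw [nIncr_skew, nIncr_refl_one, Finsupp.single_apply]
  simp [eq_comm]

lemma wt_mkTwo (p : MT × MT) :
    wt (mkTwo p) = (Finsupp.single 0 2 + Finsupp.single 1 1) + (wt' p.1 + wt p.2) := by
  ext j
  rw [Finsupp.add_apply, Finsupp.add_apply, Finsupp.add_apply, wt_apply, wt_apply]
  unfold mkTwo
  dsimp only
  rw [nIncr_skew, blk, nIncr_addMax, nIncr_skew, nIncr_refl_one]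
  rcases j with _ | _ | j
  · rw [wt'_zero, nIncr_zero]; simp; ring
  · rw [wt'_succ, nIncr_skew, nIncr_refl_one]; simp; ring
  · rw [wt'_succ, nIncr_skew, nIncr_refl_one]; simp; ring

lemma MT_ext {s t : MT} (h : s.1.1 = t.1.1)
    (h' : ∀ i (hi : i < s.1.1) (hi' : i < t.1.1), (s.1.2 ⟨i, hi⟩ : ℕ) = t.1.2 ⟨i, hi'⟩) :
    s = t := by
  obtain ⟨⟨n, σ⟩, hσ⟩ := s
  obtain ⟨⟨k, τ⟩, hτ⟩ := t
  dsimp only at h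
  subst h
  have : σ = τ := by
    ext i
    exact h' i i.2 i.2
  subst this
  rfl

lemma MT_val {s t : MT} (h : s = t) (i : ℕ) (hi : i < s.1.1) (hi' : i < t.1.1) :
    (s.1.2 ⟨i, hi⟩ : ℕ) = t.1.2 ⟨i, hi'⟩ := by
  subst h; rfl

lemma skew_val_left {a b : ℕ} (σ : Equiv.Perm (Fin a)) (τ : Equiv.Perm (Fin b)) (i : ℕ)
    (h : i < a) (h' : i < a + b) : (skew σ τ ⟨i, h'⟩ : ℕ) = b + σ ⟨i, h⟩ :=
  skew_left σ τ ⟨i, h⟩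

lemma skew_val_right {a b : ℕ} (σ : Equiv.Perm (Fin a)) (τ : Equiv.Perm (Fin b)) (i : ℕ)
    (h : i < b) (h' : a + i < a + b) : (skew σ τ ⟨a + i, h'⟩ : ℕ) = τ ⟨i, h⟩ :=
  skew_right σ τ ⟨i, h⟩

lemma addMax_val {a : ℕ} (σ : Equiv.Perm (Fin a)) (i : ℕ)
    (h : i < a) (h' : i < a + 1) : (addMax σ ⟨i, h'⟩ : ℕ) = σ ⟨i, h⟩ :=
  congrArg Fin.val (addMax_castSucc σ ⟨i, h⟩)

lemma addMax_val_last {a : ℕ} (σ : Equiv.Perm (Fin a)) (h' : a < a + 1) :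
    (addMax σ ⟨a, h'⟩ : ℕ) = a :=
  congrArg Fin.val (addMax_last σ)

/-- position of the maximum -/
lemma pos_max {n n' : ℕ} {π : Equiv.Perm (Fin n)} {π' : Equiv.Perm (Fin n')} (h : IsMotzkinPerm π)
    (h' : IsMotzkinPerm π') (e : (⟨⟨n, π⟩, h⟩ : MT) = ⟨⟨n', π'⟩, h'⟩) (i i' : ℕ) (hi : i < n)
    (hi' : i' < n') (hv : (π ⟨i, hi⟩ : ℕ) + 1 = n) (hv' : (π' ⟨i', hi'⟩ : ℕ) + 1 = n') :
    i = i' := by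
  have hn : n = n' := congrArg (fun t : MT => t.1.1) e
  subst hn
  have := MT_val e i hi hi
  dsimp only at this
  have h2 : π' ⟨i, hi⟩ = π' ⟨i', hi'⟩ := by ext; omega
  have := π'.injective h2
  simpa using this

lemma mkOne_val (t : MT) (i : ℕ) (hi : i < t.1.1) (h) :
    (((mkOne t).1.2 ⟨1 + i, h⟩ : Fin _) : ℕ) = t.1.2 ⟨i, hi⟩ :=
  skew_val_right _ t.1.2 i hi h

lemma mkTwo_val_right (p : MT × MT) (i : ℕ) (hi : i < p.2.1.1) (h) :
    (((mkTwo p).1.2 ⟨p.1.1.1 + 1 + 1 + i, h⟩ : Fin _) : ℕ) = p.2.1.2 ⟨i, hi⟩ :=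
  skew_val_right _ p.2.1.2 i hi h

lemma blk_val {a : ℕ} (σ : Equiv.Perm (Fin a)) (i : ℕ) (hi : i < a) (h : i < a + 1 + 1) :
    (blk σ ⟨i, h⟩ : ℕ) = 1 + σ ⟨i, hi⟩ := by
  rw [blk, addMax_val _ _ (by omega), skew_val_left _ _ _ hi]

lemma mkTwo_val_left (p : MT × MT) (i : ℕ) (hi : i < p.1.1.1) (h) :
    (((mkTwo p).1.2 ⟨i, h⟩ : Fin _) : ℕ) = p.2.1.1 + (1 + p.1.1.2 ⟨i, hi⟩) :=
  (skew_val_left (blk p.1.1.2) p.2.1.2 i (by omega) h).trans (by rw [blk_val _ _ hi])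

lemma mkTwo_max (p : MT × MT) (h) : (((mkTwo p).1.2 ⟨p.1.1.1 + 1, h⟩ : Fin _) : ℕ) + 1 =
    (mkTwo p).1.1 := by
  have h1 : (((mkTwo p).1.2 ⟨p.1.1.1 + 1, h⟩ : Fin _) : ℕ) = _ :=
    skew_val_left (blk p.1.1.2) p.2.1.2 (p.1.1.1 + 1) (by omega) h
  have h2 : (mkTwo p).1.1 = p.1.1.1 + 1 + 1 + p.2.1.1 := rfl
  rw [h1, h2, blk, addMax_val_last]
  omega

lemma mkOne_max (p : MT) (h) : (((mkOne p).1.2 ⟨0, h⟩ : Fin _) : ℕ) + 1 =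
    (mkOne p).1.1 := by
  have h1 : (((mkOne p).1.2 ⟨0, h⟩ : Fin _) : ℕ) = _ :=
    skew_val_left (Equiv.refl (Fin 1)) p.1.2 0 (by omega) h
  have h2 : (mkOne p).1.1 = 1 + p.1.1 := rfl
  rw [h1, h2]
  simp
  omega

lemma mkOne_size (p : MT) : (mkOne p).1.1 = 1 + p.1.1 := rfl

lemma mkTwo_size (p : MT × MT) : (mkTwo p).1.1 = p.1.1.1 + 1 + 1 + p.2.1.1 := rfl

lemma mkOne_inj {s t : MT} (h : mkOne s = mkOne t) : s = t := by
  have hn : 1 + s.1.1 = 1 + t.1.1 := congrArg (fun t : MT => t.1.1) h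
  refine MT_ext (by omega) fun i hi hi' => ?_
  have := MT_val h (1 + i) (by rw [mkOne_size]; omega) (by rw [mkOne_size]; omega)
  rwa [mkOne_val _ _ hi, mkOne_val _ _ hi'] at this

lemma mkTwo_inj {s t : MT × MT} (h : mkTwo s = mkTwo t) : s = t := by
  have hn : s.1.1.1 + 1 + 1 + s.2.1.1 = t.1.1.1 + 1 + 1 + t.2.1.1 :=
    congrArg (fun t : MT => t.1.1) h
  have ha := pos_max _ _ h (s.1.1.1 + 1) (t.1.1.1 + 1) (by omega) (by omega)
    (mkTwo_max s _) (mkTwo_max t _)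
  refine Prod.ext (MT_ext (by omega) fun i hi hi' => ?_) (MT_ext (by omega) fun i hi hi' => ?_)
  · have := MT_val h i (by rw [mkTwo_size]; omega) (by rw [mkTwo_size]; omega)
    rw [mkTwo_val_left _ _ hi, mkTwo_val_left _ _ hi'] at this
    omega
  · have := MT_val h (s.1.1.1 + 1 + 1 + i) (by rw [mkTwo_size]; omega)
      (by rw [mkTwo_size]; omega)
    rw [mkTwo_val_right _ _ hi] at this
    rw [this, ← mkTwo_val_right t i hi' (by rw [mkTwo_size]; omega)]
    congr 3
    omega

lemma mkAll_inj : Function.Injective mkAll := by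
  rintro (s | s | s) (t | t | t) h <;> dsimp [mkAll] at h
  · rfl
  · have hn : 0 = 1 + t.1.1 := congrArg (fun t : MT => t.1.1) h
    omega
  · have hn : 0 = t.1.1.1 + 1 + 1 + t.2.1.1 := congrArg (fun t : MT => t.1.1) h
    omega
  · have hn : 1 + s.1.1 = 0 := congrArg (fun t : MT => t.1.1) h
    omega
  · rw [mkOne_inj h]
  · have ha := pos_max _ _ h 0 (t.1.1.1 + 1) (by omega) (by omega)
      (mkOne_max s _) (mkTwo_max t _)
    omega
  · have hn : s.1.1.1 + 1 + 1 + s.2.1.1 = 0 := congrArg (fun t : MT => t.1.1) h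
    omega
  · have ha := pos_max _ _ h (s.1.1.1 + 1) 0 (by omega) (by omega)
      (mkTwo_max s _) (mkOne_max t _)
    omega
  · rw [mkTwo_inj h]

lemma exists_skew {a b : ℕ} (π : Equiv.Perm (Fin (a + b)))
    (h : ∀ i j : Fin (a + b), (i : ℕ) < a → a ≤ (j : ℕ) → π j < π i) :
    ∃ (σ : Equiv.Perm (Fin a)) (τ : Equiv.Perm (Fin b)), π = skew σ τ := by
  have hl : ∀ i : Fin a, b ≤ (π (Fin.castAdd b i) : ℕ) := by
    intro i
    have hc := Finset.card_le_card_of_injOn (s := Finset.univ)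
      (t := Finset.Iio (π (Fin.castAdd b i)))
      (fun j : Fin b => π (Fin.natAdd a j)) (by
        intro j _
        simp only [Finset.coe_Iio, Set.mem_Iio]
        exact h _ _ (by simp) (by simp)) (by
        intro x _ y _ hxy
        simpa using hxy)
    simpa using hc
  have hr : ∀ i : Fin b, (π (Fin.natAdd a i) : ℕ) < b := by
    intro i
    have hc := Finset.card_le_card_of_injOn (s := Finset.univ)
      (t := Finset.Ioi (π (Fin.natAdd a i)))
      (fun j : Fin a => π (Fin.castAdd b j)) (by
        intro j _
        simp only [Finset.coe_Ioi, Set.mem_Ioi]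
        exact h _ _ (by simp) (by simp)) (by
        intro x _ y _ hxy
        simpa using hxy)
    simp at hc
    have := i.2
    omega
  let f : Fin a → Fin a := fun i => ⟨π (Fin.castAdd b i) - b, by
    have := hl i; have := (π (Fin.castAdd b i)).2; have := i.2; omega⟩
  let g : Fin b → Fin b := fun i => ⟨π (Fin.natAdd a i), hr i⟩
  have hf : Function.Injective f := by
    intro x y hxy
    have := congrArg Fin.val hxy
    dsimp only [f] at this
    have h1 := hl x
    have h2 := hl y
    have : π (Fin.castAdd b x) = π (Fin.castAdd b y) := by ext; omega
    simpa using this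
  have hg : Function.Injective g := by
    intro x y hxy
    have := congrArg Fin.val hxy
    dsimp only [g] at this
    have : π (Fin.natAdd a x) = π (Fin.natAdd a y) := by ext; omega
    simpa using this
  refine ⟨Equiv.ofBijective f (Finite.injective_iff_bijective.1 hf),
    Equiv.ofBijective g (Finite.injective_iff_bijective.1 hg), ?_⟩
  ext i
  induction i using Fin.addCases with
  | left i =>
    rw [skew_left]
    have := hl i
    simp only [Equiv.ofBijective_apply, f]
    omega
  | right i =>
    rw [skew_right]
    simp [g]

lemma exists_addMax {a : ℕ} (π : Equiv.Perm (Fin (a + 1))) (h : π (Fin.last a) = Fin.last a) :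
    ∃ σ : Equiv.Perm (Fin a), π = addMax σ := by
  have hl : ∀ i : Fin a, π i.castSucc ≠ Fin.last a := by
    intro i hi
    rw [← h] at hi
    exact (Fin.castSucc_lt_last i).ne (π.injective hi)
  let f : Fin a → Fin a := fun i => (π i.castSucc).castPred (hl i)
  have hf : Function.Injective f := by
    intro x y hxy
    have := congrArg Fin.castSucc hxy
    simpa [f] using this
  refine ⟨Equiv.ofBijective f (Finite.injective_iff_bijective.1 hf), ?_⟩
  ext i
  induction i using Fin.lastCases with
  | last => rw [addMax_last, h]
  | cast i => rw [addMax_castSucc]; simp [f]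

lemma mkAll_surj_aux (k b : ℕ) (π : Equiv.Perm (Fin (k + 1 + b))) (hπ : IsMotzkinPerm π)
    (hk : (π ⟨k, by omega⟩ : ℕ) + 1 = k + 1 + b) :
    ∃ s, mkAll s = ⟨⟨k + 1 + b, π⟩, hπ⟩ := by
  have hsk : ∀ i j : Fin (k + 1 + b), (i : ℕ) < k + 1 → k + 1 ≤ (j : ℕ) → π j < π i := by
    intro i j hi hj
    have hmax : ∀ l : Fin (k + 1 + b), (l : ℕ) ≠ k → π l < π ⟨k, by omega⟩ := by
      intro l hl
      have hne : π l ≠ π ⟨k, by omega⟩ := fun h => hl (congrArg Fin.val (π.injective h))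
      have hne' : (π l : ℕ) ≠ π ⟨k, by omega⟩ := fun h => hne (Fin.ext h)
      have := (π l).2
      rw [Fin.lt_def]
      omega
    by_cases hik : (i : ℕ) = k
    · have : i = ⟨k, by omega⟩ := Fin.ext hik
      rw [this]
      exact hmax j (by omega)
    · by_contra hcon
      have hne : π i ≠ π j := fun h => by
        have := congrArg Fin.val (π.injective h); omega
      refine (avoids132_iff π).1 hπ.1 i ⟨k, by omega⟩ j ?_ ?_
        (lt_of_le_of_ne (not_lt.1 hcon) hne) (hmax j (by omega))
      · rw [Fin.lt_def]; dsimp; omega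
      · rw [Fin.lt_def]; dsimp; omega
  obtain ⟨σ, τ, rfl⟩ := exists_skew π hsk
  have hm := (motzkin_skew _ _).1 hπ
  rw [skew_val_left _ _ _ (by omega)] at hk
  have hlast : σ (Fin.last k) = Fin.last k := by
    ext
    have : Fin.last k = ⟨k, by omega⟩ := rfl
    rw [this]
    dsimp only
    omega
  obtain ⟨ρ, rfl⟩ := exists_addMax σ hlast
  rcases k with _ | a
  · refine ⟨Sum.inr (Sum.inl ⟨⟨b, τ⟩, hm.2⟩), ?_⟩
    dsimp only [mkAll, Sum.elim_inr, Sum.elim_inl, mkOne]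
    have : addMax ρ = Equiv.refl (Fin 1) :=
      Subsingleton.elim (α := Equiv.Perm (Fin 1)) _ _
    simp only [this]
  · have hmm := (motzkin_addMax _).1 hm.1
    obtain ⟨σ', o, rfl⟩ := exists_skew ρ (by
      intro i j hi hj
      refine hmm.2 i j (by omega) (by rw [Fin.lt_def]; omega))
    have ho : o = Equiv.refl (Fin 1) := Subsingleton.elim _ _
    subst ho
    refine ⟨Sum.inr (Sum.inr (⟨⟨a, σ'⟩, ((motzkin_skew _ _).1 hmm.1).1⟩, ⟨⟨b, τ⟩, hm.2⟩)), ?_⟩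
    rfl

lemma mkAll_surj : Function.Surjective mkAll := by
  rintro ⟨⟨n, π⟩, hπ⟩
  rcases n with _ | n
  · refine ⟨Sum.inl (), ?_⟩
    have : π = Equiv.refl _ := Subsingleton.elim _ _
    subst this
    rfl
  · obtain ⟨k, hk⟩ : ∃ k, k = π.symm (Fin.last n) := ⟨_, rfl⟩
    have hk' : π k = Fin.last n := by rw [hk]; simp
    obtain ⟨k, hkn⟩ := k
    obtain ⟨b, hb⟩ : ∃ b, n + 1 = k + 1 + b := ⟨n - k, by omega⟩
    have hv : (π ⟨k, hkn⟩ : ℕ) + 1 = n + 1 := by rw [hk']; simp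
    clear hk hk'
    generalize n + 1 = N at *
    subst hb
    exact mkAll_surj_aux k b π hπ hv

open MvPowerSeries in
/-- The functional equation
`N(x₁,x₂,…) = 1 + x₁ N(x₁,x₂,…) + x₁² x₂ N(x₁x₂,x₂x₃,…) N(x₁,x₂,…)`. -/
theorem Ngen_functional_equation :
    Ngen = 1 + (X 0 : MvPowerSeries ℕ ℚ) * Ngen + (X 0) ^ 2 * X 1 * NgenSub * Ngen := by
  rw [Ngen_eq, NgenSub_eq]
  have hX0 : (X 0 : MvPowerSeries ℕ ℚ) = monomial (Finsupp.single 0 1) 1 := rfl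
  have hX : (X 0 : MvPowerSeries ℕ ℚ) ^ 2 * X 1 =
      monomial (Finsupp.single 0 2 + Finsupp.single 1 1) 1 := by
    rw [X_pow_eq, X_def, monomial_mul_monomial, one_mul]
  have hfp : ∀ m, Finite {p : MT × MT // wt' p.1 + wt p.2 = m} := by
    intro m
    have := fun k => finite_size k
    refine Finite.of_injective (β := Σ k : Fin (m 0 + 1) × Fin (m 0 + 1),
      {t : MT // t.1.1 = k.1} × {t : MT // t.1.1 = k.2})
      (fun p => ⟨(⟨p.1.1.1.1, ?_⟩, ⟨p.1.2.1.1, ?_⟩), ⟨p.1.1, rfl⟩, ⟨p.1.2, rfl⟩⟩) ?_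
    · have := DFunLike.congr_fun p.2 0
      rw [Finsupp.add_apply, wt'_zero, wt_apply, nIncr_one, nIncr_one] at this
      omega
    · have := DFunLike.congr_fun p.2 0
      rw [Finsupp.add_apply, wt'_zero, wt_apply, nIncr_one, nIncr_one] at this
      omega
    · intro p q h
      have h1 := congrArg (fun z : (Σ k : Fin (m 0 + 1) × Fin (m 0 + 1),
        {t : MT // t.1.1 = k.1} × {t : MT // t.1.1 = k.2}) => (z.2.1.1, z.2.2.1)) h
      exact Subtype.ext h1
  have hinj : ∀ {T : Type} (w : T → (ℕ →₀ ℕ)) (d : ℕ →₀ ℕ),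
      (∀ m, Finite {t // w t = m}) → ∀ m, Finite {t // d + w t = m} := by
    intro T w d h m
    have := h (m - d)
    refine Finite.of_injective (β := {t // w t = m - d})
      (fun t => ⟨t.1, eq_tsub_of_add_eq (by rw [add_comm]; exact t.2)⟩) ?_
    intro x y hxy
    simp only [Subtype.mk.injEq] at hxy
    exact Subtype.ext hxy
  have h2 := hinj wt (Finsupp.single 0 1) wt_fin
  have h3 := hinj _ (Finsupp.single 0 2 + Finsupp.single 1 1) hfp
  rw [hX, hX0, mul_assoc, ← wGF_prod wt' wt wt'_fin wt_fin, ← wGF_shift _,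
    ← wGF_shift _, add_assoc, ← wGF_sum _ _ h2 h3, ← wGF_unit, ← wGF_sum]
  · refine wGF_congr (Equiv.ofBijective mkAll ⟨mkAll_inj, mkAll_surj⟩) _ _ ?_
    rintro (s | s | s)
    · exact wt_mkZero
    · exact wt_mkOne s
    · exact wt_mkTwo s
  · intro m; infer_instance
  · intro m
    have := h2 m
    have := h3 m
    refine @Finite.of_equiv _ _ ?_ (Equiv.subtypeSum (p := fun z => Sum.elim _ _ z = m)).symm
    exact @Finite.instSum _ _ (h2 m) (h3 m)
end
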